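/- arXiv:math/9503205 — 10 statements merged into one kernel-verified Lean document; each statement's English description precedes it below -/
import Mathlib

section
/- There exists a computable injective function f : ℕ → ℕ such that for every e : ℕ, the code Nat.Partrec.Code.ofNat (f e) codes a recursive graph, and the graph it codes is 3-colorable if and only if e ∉ K (the e-th partial recursive function diverges on input e). In particular, the halting set K is one-one reducible to the set of (numbers of) codes of recursive graphs that are not 3-colorable, and the complement of K is one-one reducible to the set of codes of recursive graphs that are 3-colorable. -/
/-- A code `c` codes a recursive graph if on every pair code it converges to `0` or `1`,
symmetrically, with value `0` on the diagonal. -/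
def codesGraph (c : Nat.Partrec.Code) : Prop :=
  ∀ m n : ℕ,
    (c.eval (Nat.pair m n) = Part.some 0 ∨ c.eval (Nat.pair m n) = Part.some 1) ∧
    c.eval (Nat.pair m n) = c.eval (Nat.pair n m) ∧
    (m = n → c.eval (Nat.pair m n) = Part.some 0)

/-- The graph on `ℕ` coded by `c`: `m` and `n` are adjacent iff the value at `(m, n)` is `1`. -/
def codedGraph (c : Nat.Partrec.Code) : SimpleGraph ℕ :=
  SimpleGraph.fromRel (fun m n => c.eval (Nat.pair m n) = Part.some 1)

open Nat.Partrec in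
/-- The indicator that `{e}` halts on input `e` within both `m` and `n` steps, where `m ≠ n`;
the argument codes `(e, (m, n))`. -/
def haltingEdge (p : ℕ) : ℕ :=
  let e := p.unpair.1
  let q := p.unpair.2.unpair
  if q.1 = q.2 then 0 else
    bif (Code.evaln q.1 (Denumerable.ofNat Code e) e).isSome &&
      (Code.evaln q.2 (Denumerable.ofNat Code e) e).isSome then 1 else 0

theorem primrec_haltingEdge : Primrec haltingEdge := by
  have he : Primrec fun p : ℕ => p.unpair.1 := Primrec.fst.comp Primrec.unpair
  have hq : Primrec fun p : ℕ => p.unpair.2.unpair :=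
    Primrec.unpair.comp (Primrec.snd.comp Primrec.unpair)
  have hc : Primrec fun p : ℕ => Denumerable.ofNat Nat.Partrec.Code p.unpair.1 :=
    (Primrec.ofNat _).comp he
  have hs : ∀ {g : ℕ → ℕ}, Primrec g → Primrec fun p : ℕ =>
      (Nat.Partrec.Code.evaln (g p) (Denumerable.ofNat _ p.unpair.1) p.unpair.1).isSome :=
    fun hg => Primrec.option_isSome.comp
      (Nat.Partrec.Code.primrec_evaln.comp ((hg.pair hc).pair he))
  exact Primrec.ite (Primrec.eq.comp (Primrec.fst.comp hq) (Primrec.snd.comp hq))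
    (Primrec.const 0)
    (Primrec.cond (Primrec.and.comp (hs (Primrec.fst.comp hq)) (hs (Primrec.snd.comp hq)))
      (Primrec.const 1) (Primrec.const 0))

theorem haltingEdge_pair_eq_one_iff (e m n : ℕ) :
    haltingEdge (Nat.pair e (Nat.pair m n)) = 1 ↔ m ≠ n ∧
      (Nat.Partrec.Code.evaln m (Denumerable.ofNat _ e) e).isSome ∧
      (Nat.Partrec.Code.evaln n (Denumerable.ofNat _ e) e).isSome := by
  simp only [haltingEdge, Nat.unpair_pair, cond_eq_ite]
  split_ifs <;> simp_all

theorem haltingEdge_eq_zero_or_one (p : ℕ) : haltingEdge p = 0 ∨ haltingEdge p = 1 := by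
  simp only [haltingEdge, cond_eq_ite]
  split_ifs <;> simp

theorem codesGraph_of_eval_eq_haltingEdge {c : Nat.Partrec.Code} {e : ℕ}
    (hc : ∀ m n, c.eval (Nat.pair m n) = Part.some (haltingEdge (Nat.pair e (Nat.pair m n)))) :
    codesGraph c := by
  intro m n
  rw [hc, hc]
  simp only [Part.some_inj]
  have hmn := haltingEdge_pair_eq_one_iff e m n
  have hnm := haltingEdge_pair_eq_one_iff e n m
  have hm := haltingEdge_eq_zero_or_one (Nat.pair e (Nat.pair m n))
  have hn := haltingEdge_eq_zero_or_one (Nat.pair e (Nat.pair n m))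
  refine ⟨hm, ?_, ?_⟩ <;> grind

theorem codedGraph_adj_iff_of_eval_eq_haltingEdge {c : Nat.Partrec.Code} {e : ℕ}
    (hc : ∀ m n, c.eval (Nat.pair m n) = Part.some (haltingEdge (Nat.pair e (Nat.pair m n))))
    (m n : ℕ) :
    (codedGraph c).Adj m n ↔ m ≠ n ∧
      (Nat.Partrec.Code.evaln m (Denumerable.ofNat _ e) e).isSome ∧
      (Nat.Partrec.Code.evaln n (Denumerable.ofNat _ e) e).isSome := by
  simp only [codedGraph, SimpleGraph.fromRel_adj, hc, Part.some_inj, haltingEdge_pair_eq_one_iff]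
  grind

theorem codedGraph_colorable_iff_of_eval_eq_haltingEdge {c : Nat.Partrec.Code} {e : ℕ}
    (hc : ∀ m n, c.eval (Nat.pair m n) = Part.some (haltingEdge (Nat.pair e (Nat.pair m n))))
    (k : ℕ) (hk : k ≠ 0) :
    (codedGraph c).Colorable k ↔
      ¬ ((Denumerable.ofNat Nat.Partrec.Code e).eval e).Dom := by
  have adj := codedGraph_adj_iff_of_eval_eq_haltingEdge hc
  constructor
  · rintro ⟨C⟩ hdom
    obtain ⟨x, hx⟩ := Part.dom_iff_mem.1 hdom
    obtain ⟨s, hs⟩ := Nat.Partrec.Code.evaln_complete.1 hx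
    have hsome (i : ℕ) : (Nat.Partrec.Code.evaln (s + i) (Denumerable.ofNat _ e) e).isSome :=
      Option.isSome_iff_exists.2 ⟨x, Nat.Partrec.Code.evaln_mono (Nat.le_add_right s i) hs⟩
    refine not_injective_infinite_finite (fun i => C (s + i)) fun i j hij => ?_
    by_contra hne
    exact C.valid ((adj _ _).2 ⟨by omega, hsome i, hsome j⟩) hij
  · intro hdom
    refine ⟨SimpleGraph.Coloring.mk (fun _ => ⟨0, Nat.pos_of_ne_zero hk⟩) fun {m n} h => ?_⟩
    obtain ⟨x, hx⟩ := Option.isSome_iff_exists.1 ((adj m n).1 h).2.1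
    exact absurd (Part.dom_iff_mem.2 ⟨x, Nat.Partrec.Code.evaln_sound hx⟩) hdom

theorem stmt2 :
    ∃ f : ℕ → ℕ, Computable f ∧ Function.Injective f ∧
      (∀ e : ℕ, codesGraph (Denumerable.ofNat Nat.Partrec.Code (f e)) ∧
        ((codedGraph (Denumerable.ofNat Nat.Partrec.Code (f e))).Colorable 3 ↔
          ¬ ((Denumerable.ofNat Nat.Partrec.Code e).eval e).Dom)) ∧
      OneOneReducible
        (fun e : ℕ => ((Denumerable.ofNat Nat.Partrec.Code e).eval e).Dom)
        (fun c : ℕ => codesGraph (Denumerable.ofNat Nat.Partrec.Code c) ∧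
          ¬ (codedGraph (Denumerable.ofNat Nat.Partrec.Code c)).Colorable 3) ∧
      OneOneReducible
        (fun e : ℕ => ¬ ((Denumerable.ofNat Nat.Partrec.Code e).eval e).Dom)
        (fun c : ℕ => codesGraph (Denumerable.ofNat Nat.Partrec.Code c) ∧
          (codedGraph (Denumerable.ofNat Nat.Partrec.Code c)).Colorable 3) := by
  obtain ⟨c₀, hc₀⟩ := Nat.Partrec.Code.exists_code.1
    (Partrec.nat_iff.1 primrec_haltingEdge.to_comp.partrec)
  let f (e : ℕ) : ℕ := Encodable.encode (c₀.curry e)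
  have hf : Computable f := (Primrec.encode.comp
    (Nat.Partrec.Code.primrec₂_curry.comp (Primrec.const c₀) Primrec.id)).to_comp
  have hinj : Function.Injective f := fun a b h =>
    (Nat.Partrec.Code.curry_inj (Encodable.encode_injective h)).2
  have heval (e m n : ℕ) : (Denumerable.ofNat Nat.Partrec.Code (f e)).eval (Nat.pair m n) =
      Part.some (haltingEdge (Nat.pair e (Nat.pair m n))) := by
    simp only [f, Denumerable.ofNat_encode, Nat.Partrec.Code.eval_curry, hc₀]
    rfl
  have hgraph (e : ℕ) := codesGraph_of_eval_eq_haltingEdge (heval e)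
  have hcol (e : ℕ) :=
    codedGraph_colorable_iff_of_eval_eq_haltingEdge (heval e) 3 three_ne_zero
  refine ⟨f, hf, hinj, fun e => ⟨hgraph e, hcol e⟩, ⟨f, hf, hinj, fun e => ?_⟩,
    ⟨f, hf, hinj, fun e => ?_⟩⟩
  · simp only [hgraph e, hcol e, true_and, not_not]
  · simp only [hgraph e, hcol e, true_and]
end

section
/- For each e : ℕ, let G_e be the following simple graph. Its vertices are the labeled vertices v_{m,j} for m, j : ℕ together with, for each m, additional vertices u_{m,1}, …, u_{m,m}. Its edges are: v_{m,j} ~ v_{m,j+1} for all m, j; the m+1 vertices v_{m,0}, u_{m,1}, …, u_{m,m} are pairwise adjacent (a clique on m+1 vertices); and v_{m,j} ~ v_{m+1,j} if and only if the computation of {e} on input m halts within j steps. Then: W_e is cofinite if and only if G_e has a connected component whose induced subgraph is not n-colorable for any n : ℕ; moreover, if W_e is not cofinite, then every connected component of G_e is finitely colorable. -/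
/-- Vertices of the graph `G_e`: labeled vertices `v_{m,j}` (left) together with, for each `m`,
additional vertices `u_{m,1}, …, u_{m,m}` (right). -/
def V4 : Type := (ℕ × ℕ) ⊕ {p : ℕ × ℕ // 1 ≤ p.2 ∧ p.2 ≤ p.1}

/-- Base edge relation of `G_e`:  `v_{m,j} ~ v_{m,j+1}`;  `v_{m,j} ~ v_{m+1,j}` iff `{e}(m)`
halts within `j` steps;  and `v_{m,0}, u_{m,1}, …, u_{m,m}` pairwise adjacent. -/
def rel4 (e : ℕ) : V4 → V4 → Prop
  | Sum.inl (m, j), Sum.inl (m', j') =>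
      (m' = m ∧ j' = j + 1) ∨
      (m' = m + 1 ∧ j' = j ∧
        (Nat.Partrec.Code.evaln j (Denumerable.ofNat Nat.Partrec.Code e) m).isSome)
  | Sum.inl (m, j), Sum.inr ⟨(m', _), _⟩ => m' = m ∧ j = 0
  | Sum.inr ⟨(m, _), _⟩, Sum.inr ⟨(m', _), _⟩ => m' = m
  | _, _ => False

/-- The graph `G_e`. -/
def G4 (e : ℕ) : SimpleGraph V4 := SimpleGraph.fromRel (rel4 e)

namespace V4

/-- The column `m` of a vertex `v_{m,j}` or `u_{m,i}`. -/
def column : V4 → ℕ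
  | Sum.inl (m, _) => m
  | Sum.inr ⟨(m, _), _⟩ => m

/-- A proper coloring of `G4 e` by natural numbers, at most `m + 1` on column `m`. -/
def color : V4 → ℕ
  | Sum.inl (m, j) => (m + j) % 2
  | Sum.inr ⟨(_, i), _⟩ => i + 1

/-- The `m + 1` vertices `v_{m,0}, u_{m,1}, …, u_{m,m}` of the clique in column `m`. -/
def clique (m : ℕ) : Fin (m + 1) → V4
  | ⟨0, _⟩ => Sum.inl (m, 0)
  | ⟨i + 1, h⟩ => Sum.inr ⟨(m, i + 1), Nat.le_add_left 1 i, Nat.lt_succ_iff.1 h⟩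

theorem color_le (x : V4) : x.color ≤ x.column + 1 := by
  rcases x with ⟨m, j⟩ | ⟨⟨m, i⟩, h⟩ <;> simp only [color, column] at * <;> omega

end V4

theorem rel4_color_ne {e : ℕ} {x y : V4} (hne : x ≠ y) (h : rel4 e x y) :
    x.color ≠ y.color := by
  rcases x with ⟨m, j⟩ | ⟨⟨m, i⟩, hi⟩ <;> rcases y with ⟨m', j'⟩ | ⟨⟨m', i'⟩, hi'⟩ <;>
    simp only [rel4, V4.color] at *
  · omega
  · omega
  · rintro h'
    obtain rfl : i = i' := by omega
    subst h
    exact hne rfl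

theorem G4_color_ne {e : ℕ} {x y : V4} (h : (G4 e).Adj x y) : x.color ≠ y.color := by
  obtain ⟨hne, h | h⟩ := (SimpleGraph.fromRel_adj _ _ _).1 h
  · exact rel4_color_ne hne h
  · exact (rel4_color_ne hne.symm h).symm

theorem evaln_isSome_dom {c : Nat.Partrec.Code} {j m : ℕ} (h : (c.evaln j m).isSome) :
    (c.eval m).Dom := by
  obtain ⟨x, hx⟩ := Option.isSome_iff_exists.1 h
  exact Part.dom_iff_mem.2 ⟨x, Nat.Partrec.Code.evaln_sound hx⟩

theorem exists_evaln_isSome {c : Nat.Partrec.Code} {m : ℕ} (h : (c.eval m).Dom) :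
    ∃ j, (c.evaln j m).isSome := by
  obtain ⟨x, hx⟩ := Part.dom_iff_mem.1 h
  obtain ⟨j, hj⟩ := Nat.Partrec.Code.evaln_complete.1 hx
  exact ⟨j, Option.isSome_iff_exists.2 ⟨x, hj⟩⟩

theorem rel4_column_le_iff {e m : ℕ}
    (hm : ¬ ((Denumerable.ofNat Nat.Partrec.Code e).eval m).Dom) {x y : V4}
    (h : rel4 e x y) : x.column ≤ m ↔ y.column ≤ m := by
  rcases x with ⟨k, j⟩ | ⟨⟨k, i⟩, hi⟩ <;> rcases y with ⟨k', j'⟩ | ⟨⟨k', i'⟩, hi'⟩ <;>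
    simp only [rel4, V4.column] at *
  · rcases h with h | ⟨h, -, h'⟩
    · omega
    · have : k ≠ m := by
        rintro rfl
        exact hm (evaln_isSome_dom h')
      omega
  · omega
  · omega

theorem G4_column_le_of_reachable {e m : ℕ}
    (hm : ¬ ((Denumerable.ofNat Nat.Partrec.Code e).eval m).Dom) {x y : V4}
    (h : (G4 e).Reachable x y) (hx : x.column ≤ m) : y.column ≤ m := by
  obtain ⟨p⟩ := h
  induction p with
  | nil => exact hx
  | cons h _ ih =>
    obtain ⟨-, h | h⟩ := (SimpleGraph.fromRel_adj _ _ _).1 h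
    · exact ih ((rel4_column_le_iff hm h).1 hx)
    · exact ih ((rel4_column_le_iff hm h).2 hx)

theorem G4_exists_colorable_of_infinite {e : ℕ}
    (h : ¬ {n : ℕ | ((Denumerable.ofNat Nat.Partrec.Code e).eval n).Dom}ᶜ.Finite)
    (C : (G4 e).ConnectedComponent) : ∃ n : ℕ, ((G4 e).induce C.supp).Colorable n := by
  obtain ⟨v, rfl⟩ := C.exists_rep
  obtain ⟨m, hm, hvm⟩ := Set.Infinite.exists_gt h v.column
  have hle (x : ((G4 e).connectedComponentMk v).supp) : x.1.column ≤ m :=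
    G4_column_le_of_reachable hm (SimpleGraph.ConnectedComponent.exact x.2).symm hvm.le
  refine ⟨m + 2, ⟨SimpleGraph.Coloring.mk
    (fun x => ⟨x.1.color, by have := x.1.color_le; have := hle x; omega⟩) ?_⟩⟩
  intro x y hxy hc
  exact G4_color_ne hxy (congrArg Fin.val hc)

theorem G4_reachable_column (e m j : ℕ) :
    (G4 e).Reachable (Sum.inl (m, 0)) (Sum.inl (m, j)) := by
  induction j with
  | zero => exact SimpleGraph.Reachable.refl _
  | succ j ih =>
    refine ih.trans (SimpleGraph.Adj.reachable ((SimpleGraph.fromRel_adj _ _ _).2 ⟨?_, Or.inl ?_⟩))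
    · intro h
      have := congrArg Prod.snd (Sum.inl.inj h)
      simp at this
    · exact Or.inl ⟨rfl, rfl⟩

theorem G4_reachable_succ {e m : ℕ}
    (h : ((Denumerable.ofNat Nat.Partrec.Code e).eval m).Dom) :
    (G4 e).Reachable (Sum.inl (m, 0)) (Sum.inl (m + 1, 0)) := by
  obtain ⟨j, hj⟩ := exists_evaln_isSome h
  refine (G4_reachable_column e m j).trans (SimpleGraph.Reachable.trans (SimpleGraph.Adj.reachable
    ((SimpleGraph.fromRel_adj _ _ _).2 ⟨?_, Or.inl ?_⟩)) (G4_reachable_column e (m + 1) j).symm)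
  · intro h
    have := congrArg Prod.fst (Sum.inl.inj h)
    simp at this
  · exact Or.inr ⟨rfl, rfl, hj⟩

theorem G4_reachable_of_le {e M m : ℕ}
    (h : ∀ n, M ≤ n → ((Denumerable.ofNat Nat.Partrec.Code e).eval n).Dom) (hm : M ≤ m) :
    (G4 e).Reachable (Sum.inl (M, 0)) (Sum.inl (m, 0)) := by
  induction m, hm using Nat.le_induction with
  | base => exact SimpleGraph.Reachable.refl _
  | succ m hm ih => exact ih.trans (G4_reachable_succ (h m hm))

theorem G4_adj_clique (e : ℕ) {m : ℕ} {i j : Fin (m + 1)} (hij : i ≠ j) :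
    (G4 e).Adj (V4.clique m i) (V4.clique m j) := by
  refine (SimpleGraph.fromRel_adj _ _ _).2 ?_
  rcases i with ⟨_ | i, hi⟩ <;> rcases j with ⟨_ | j, hj⟩
  · exact absurd rfl hij
  · exact ⟨Sum.inl_ne_inr, Or.inl ⟨rfl, rfl⟩⟩
  · exact ⟨Sum.inr_ne_inl, Or.inr ⟨rfl, rfl⟩⟩
  · refine ⟨fun h => hij (Fin.ext ?_), Or.inl rfl⟩
    exact congrArg (fun p => p.1.2) (Sum.inr.inj h)

theorem G4_reachable_clique (e m : ℕ) (i : Fin (m + 1)) :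
    (G4 e).Reachable (Sum.inl (m, 0)) (V4.clique m i) := by
  by_cases hi : i = 0
  · subst hi
    exact SimpleGraph.Reachable.refl _
  · exact (G4_adj_clique e (Ne.symm hi)).reachable

theorem G4_exists_not_colorable_of_finite {e : ℕ}
    (h : {n : ℕ | ((Denumerable.ofNat Nat.Partrec.Code e).eval n).Dom}ᶜ.Finite) :
    ∃ C : (G4 e).ConnectedComponent, ∀ n : ℕ, ¬ ((G4 e).induce C.supp).Colorable n := by
  obtain ⟨B, hB⟩ := h.bddAbove
  have hdom (n : ℕ) (hn : B + 1 ≤ n) :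
      ((Denumerable.ofNat Nat.Partrec.Code e).eval n).Dom := by
    by_contra hc
    have : n ≤ B := hB hc
    omega
  refine ⟨(G4 e).connectedComponentMk (Sum.inl (B + 1, 0)), fun n ⟨f⟩ => ?_⟩
  have hmem (i : Fin (max n (B + 1) + 1)) : V4.clique _ i ∈
      ((G4 e).connectedComponentMk (Sum.inl (B + 1, 0))).supp :=
    SimpleGraph.ConnectedComponent.sound
      ((G4_reachable_of_le hdom (le_max_right _ _)).trans (G4_reachable_clique e _ i)).symm
  have hinj : Function.Injective fun i => f ⟨V4.clique _ i, hmem i⟩ := by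
    intro i j hij
    by_contra hne
    exact f.valid (v := ⟨_, hmem i⟩) (w := ⟨_, hmem j⟩) (G4_adj_clique e hne) hij
  have := Fintype.card_le_of_injective _ hinj
  simp only [Fintype.card_fin] at this
  omega

theorem stmt4 (e : ℕ) :
    ({n : ℕ | ((Denumerable.ofNat Nat.Partrec.Code e).eval n).Dom}ᶜ.Finite ↔
      ∃ C : (G4 e).ConnectedComponent, ∀ n : ℕ, ¬ ((G4 e).induce C.supp).Colorable n) ∧
    (¬ {n : ℕ | ((Denumerable.ofNat Nat.Partrec.Code e).eval n).Dom}ᶜ.Finite →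
      ∀ C : (G4 e).ConnectedComponent, ∃ n : ℕ, ((G4 e).induce C.supp).Colorable n) := by
  refine ⟨⟨G4_exists_not_colorable_of_finite, fun ⟨C, hC⟩ => ?_⟩, G4_exists_colorable_of_infinite⟩
  by_contra h
  obtain ⟨n, hn⟩ := G4_exists_colorable_of_infinite h C
  exact hC n hn
end

section
/- There exists a computable injective function f : ℕ → ℕ such that for every e : ℕ, the code Nat.Partrec.Code.ofNat (f e) codes a recursive graph, and the coded graph has a connected component that is not finitely colorable if and only if W_e is cofinite. In particular, the set Cof = {e | W_e is cofinite} is one-one reducible to the set of (numbers of) codes of recursive graphs having a connected component that is not finitely colorable. -/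
/-- The graph `G` has a connected component that is not finitely colorable. -/
def HasNonFinColorableComponent (G : SimpleGraph ℕ) : Prop :=
  ∃ C : G.ConnectedComponent, ∀ n : ℕ, ¬ (G.induce C.supp).Colorable n

open Nat.Partrec (Code)

/-- The directed edges of the graph attached to `c`, vertices being read as pairs `(row, index)`:
in row `n` the vertex `0` is joined to everything and the vertices `0, …, n` form a clique; the
vertex `s` of row `n` is joined to the vertex `0` of row `n + 1` when `c` halts on `n` within `s`
steps. -/
def RowEdge (c : Code) (u v : ℕ × ℕ) : Prop :=
  (u.1 = v.1 ∧ u.2 ≠ v.2 ∧ (u.2 = 0 ∨ (u.2 ≤ u.1 ∧ v.2 ≤ u.1))) ∨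
    (v.1 = u.1 + 1 ∧ v.2 = 0 ∧ (Code.evaln u.2 c u.1).isSome = true)

instance (c : Code) (u v : ℕ × ℕ) : Decidable (RowEdge c u v) := by
  unfold RowEdge; infer_instance

theorem RowEdge.ne {c : Code} {u v : ℕ × ℕ} (h : RowEdge c u v) : u ≠ v := by
  rintro rfl
  rcases h with ⟨_, h, _⟩ | ⟨h, _⟩
  · exact h rfl
  · omega

theorem primrecPred_rowEdge {α : Type*} [Primcodable α] {c : α → Code} {u v : α → ℕ × ℕ}
    (hc : Primrec c) (hu : Primrec u) (hv : Primrec v) :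
    PrimrecPred fun a => RowEdge (c a) (u a) (v a) := by
  have u₁ := Primrec.fst.comp hu
  have u₂ := Primrec.snd.comp hu
  have v₁ := Primrec.fst.comp hv
  have v₂ := Primrec.snd.comp hv
  have halt : PrimrecPred fun a => (Code.evaln (u a).2 (c a) (u a).1).isSome = true :=
    Primrec.eq.comp
      (Primrec.option_isSome.comp (Code.primrec_evaln.comp ((u₂.pair hc).pair u₁)))
      (Primrec.const true)
  exact ((Primrec.eq.comp u₁ v₁).and ((Primrec.eq.comp u₂ v₂).not.and
    ((Primrec.eq.comp u₂ (Primrec.const 0)).or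
      ((Primrec.nat_le.comp u₂ u₁).and (Primrec.nat_le.comp v₂ u₁))))).or
    ((Primrec.eq.comp v₁ (Primrec.succ.comp u₁)).and
      ((Primrec.eq.comp v₂ (Primrec.const 0)).and halt))

/-- The characteristic function of the symmetrized edge relation attached to `c`. -/
def rowGraphValue (c : Code) (p : ℕ) : ℕ :=
  if RowEdge c p.unpair.1.unpair p.unpair.2.unpair ∨
    RowEdge c p.unpair.2.unpair p.unpair.1.unpair then 1 else 0

theorem primrec_rowGraphValue :
    Primrec fun p : ℕ =>
      rowGraphValue (Denumerable.ofNat Code p.unpair.1) p.unpair.2 := by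
  have hc : Primrec fun p : ℕ => Denumerable.ofNat Code p.unpair.1 :=
    (Primrec.ofNat Code).comp (Primrec.fst.comp Primrec.unpair)
  have hp : Primrec fun p : ℕ => p.unpair.2.unpair :=
    Primrec.unpair.comp (Primrec.snd.comp Primrec.unpair)
  have hu := Primrec.unpair.comp (Primrec.fst.comp hp)
  have hv := Primrec.unpair.comp (Primrec.snd.comp hp)
  exact Primrec.ite ((primrecPred_rowEdge hc hu hv).or (primrecPred_rowEdge hc hv hu))
    (Primrec.const 1) (Primrec.const 0)

/-- A computable injection sending `e` to a code of `rowGraphValue` for the `e`-th code. -/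
theorem exists_rowGraph_code :
    ∃ f : ℕ → ℕ, Computable f ∧ Function.Injective f ∧ ∀ e p : ℕ,
      (Denumerable.ofNat Code (f e)).eval p =
        Part.some (rowGraphValue (Denumerable.ofNat Code e) p) := by
  obtain ⟨c, hc⟩ := Code.exists_code.1 (Partrec.nat_iff.1 primrec_rowGraphValue.to_comp)
  refine ⟨fun e => Encodable.encode (Code.curry c e), ?_, ?_, ?_⟩
  · exact (Primrec.encode.comp
      (Code.primrec₂_curry.comp (Primrec.const c) Primrec.id)).to_comp
  · intro a b h
    exact (Code.curry_inj (Encodable.encode_injective h)).2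
  · intro e p
    rw [Denumerable.ofNat_encode, Code.eval_curry, hc]
    simp

theorem codesGraph_of_eval {d c : Code}
    (hd : ∀ p, d.eval p = Part.some (rowGraphValue c p)) : codesGraph d := by
  intro m n
  simp only [hd, Part.some_inj, rowGraphValue, Nat.unpair_pair]
  refine ⟨by split_ifs <;> simp, by simp only [or_comm], ?_⟩
  rintro rfl
  rw [if_neg]
  rintro (h | h) <;> exact h.ne rfl

theorem codedGraph_adj_iff {d c : Code}
    (hd : ∀ p, d.eval p = Part.some (rowGraphValue c p)) (m n : ℕ) :
    (codedGraph d).Adj m n ↔ RowEdge c m.unpair n.unpair ∨ RowEdge c n.unpair m.unpair := by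
  have key : ∀ m n : ℕ, d.eval (Nat.pair m n) = Part.some 1 ↔
      RowEdge c m.unpair n.unpair ∨ RowEdge c n.unpair m.unpair := by
    intro m n
    simp only [hd, Part.some_inj, rowGraphValue, Nat.unpair_pair]
    split_ifs with h <;> simp [h]
  rw [codedGraph, SimpleGraph.fromRel_adj, key, key]
  constructor
  · rintro ⟨_, h | h⟩
    · exact h
    · exact h.symm
  · intro h
    refine ⟨?_, Or.inl h⟩
    rintro rfl
    rcases h with h | h <;> exact h.ne rfl

theorem codedGraph_adj_pair {d c : Code}
    (hd : ∀ p, d.eval p = Part.some (rowGraphValue c p)) {u v : ℕ × ℕ} (h : RowEdge c u v) :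
    (codedGraph d).Adj (Nat.pair u.1 u.2) (Nat.pair v.1 v.2) := by
  rw [codedGraph_adj_iff hd]
  simpa using Or.inl h

/-- When `c` halts on every input from `N` on, the rows from `N` on lie in one component. -/
theorem codedGraph_reachable {d c : Code}
    (hd : ∀ p, d.eval p = Part.some (rowGraphValue c p)) {N : ℕ}
    (hN : ∀ n, N ≤ n → (c.eval n).Dom) {n : ℕ} (hn : N ≤ n) (i : ℕ) :
    (codedGraph d).Reachable (Nat.pair N 0) (Nat.pair n i) := by
  have row : ∀ n i, (codedGraph d).Reachable (Nat.pair n 0) (Nat.pair n i) := by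
    intro n i
    rcases Nat.eq_zero_or_pos i with rfl | hi
    · exact SimpleGraph.Reachable.refl _
    · exact (codedGraph_adj_pair hd (u := (n, 0)) (v := (n, i))
        (Or.inl ⟨rfl, hi.ne, Or.inl rfl⟩)).reachable
  refine SimpleGraph.Reachable.trans ?_ (row n i)
  induction n, hn using Nat.le_induction with
  | base => exact SimpleGraph.Reachable.refl _
  | succ n hn ih =>
    obtain ⟨x, hx⟩ := Part.dom_iff_mem.1 (hN n hn)
    obtain ⟨s, hs⟩ := Code.evaln_complete.1 hx
    refine (ih.trans (row n s)).trans (codedGraph_adj_pair hd (u := (n, s)) (v := (n + 1, 0))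
      (Or.inr ⟨rfl, rfl, ?_⟩)).reachable
    exact Option.isSome_iff_exists.2 ⟨x, hs⟩

/-- When `c` diverges on `N`, the rows up to `N` are closed under adjacency. -/
theorem codedGraph_row_le {d c : Code}
    (hd : ∀ p, d.eval p = Part.some (rowGraphValue c p)) {N : ℕ} (hN : ¬ (c.eval N).Dom)
    {u v : ℕ} (h : (codedGraph d).Reachable u v) (hu : u.unpair.1 ≤ N) : v.unpair.1 ≤ N := by
  obtain ⟨w⟩ := h
  induction w with
  | nil => exact hu
  | cons hadj _ ih =>
    apply ih
    rcases (codedGraph_adj_iff hd _ _).1 hadj with (⟨h, _⟩ | ⟨h, _, hs⟩) | (⟨h, _⟩ | ⟨h, _⟩)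
    · omega
    · rcases Nat.lt_or_eq_of_le hu with hlt | heq
      · omega
      · obtain ⟨x, hx⟩ := Option.isSome_iff_exists.1 hs
        exact absurd (Part.dom_iff_mem.2 ⟨x, heq ▸ Code.evaln_sound hx⟩) hN
    · omega
    · omega

theorem hasNonFinColorableComponent_codedGraph_iff {d c : Code}
    (hd : ∀ p, d.eval p = Part.some (rowGraphValue c p)) :
    HasNonFinColorableComponent (codedGraph d) ↔ {n : ℕ | (c.eval n).Dom}ᶜ.Finite := by
  constructor
  · rintro ⟨C, hC⟩
    by_contra hinf
    induction C using SimpleGraph.ConnectedComponent.ind with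
    | h v =>
    obtain ⟨N, hN, hvN⟩ := Set.Infinite.exists_gt hinf v.unpair.1
    have hrow : ∀ x : ((codedGraph d).connectedComponentMk v).supp, x.1.unpair.1 ≤ N := fun x =>
      codedGraph_row_le hd hN (SimpleGraph.ConnectedComponent.exact x.2).symm hvN.le
    have col : ((codedGraph d).induce ((codedGraph d).connectedComponentMk v).supp).Coloring
        (Fin (N + 1) × Fin (N + 2)) :=
      SimpleGraph.Coloring.mk
        (fun x => (⟨x.1.unpair.1, Nat.lt_succ_of_le (hrow x)⟩,
          ⟨min x.1.unpair.2 (x.1.unpair.1 + 1), by have := hrow x; omega⟩)) (by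
        intro x y hxy heq
        simp only [Prod.mk.injEq, Fin.mk.injEq] at heq
        have := (codedGraph_adj_iff hd _ _).1 (SimpleGraph.comap_adj.1 hxy)
        simp only [RowEdge, Function.Embedding.subtype_apply] at this
        omega)
    exact hC _ col.colorable
  · intro hfin
    obtain ⟨B, hB⟩ := hfin.bddAbove
    have hN : ∀ n, B + 1 ≤ n → (c.eval n).Dom := by
      intro n hn
      by_contra hdom
      have := hB hdom
      omega
    refine ⟨(codedGraph d).connectedComponentMk (Nat.pair (B + 1) 0), fun k ⟨col⟩ => ?_⟩
    have hmem : ∀ i, Nat.pair (B + 1 + k) i ∈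
        ((codedGraph d).connectedComponentMk (Nat.pair (B + 1) 0)).supp := fun i =>
      SimpleGraph.ConnectedComponent.sound (codedGraph_reachable hd hN (by omega) i).symm
    have hinj : Function.Injective fun i : Fin (k + 1) => col ⟨_, hmem i⟩ := by
      intro i j hij
      by_contra hne
      refine col.valid ?_ hij
      rw [SimpleGraph.comap_adj]
      exact codedGraph_adj_pair hd (u := (B + 1 + k, (i : ℕ))) (v := (B + 1 + k, (j : ℕ)))
        (Or.inl ⟨rfl, fun h => hne (Fin.ext h), Or.inr ⟨by dsimp; omega, by dsimp; omega⟩⟩)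
    have := Fintype.card_le_of_injective _ hinj
    simp at this

theorem stmt5 :
    ∃ f : ℕ → ℕ, Computable f ∧ Function.Injective f ∧
      (∀ e : ℕ, codesGraph (Denumerable.ofNat Nat.Partrec.Code (f e)) ∧
        (HasNonFinColorableComponent (codedGraph (Denumerable.ofNat Nat.Partrec.Code (f e))) ↔
          {n : ℕ | ((Denumerable.ofNat Nat.Partrec.Code e).eval n).Dom}ᶜ.Finite)) ∧
      OneOneReducible
        (fun e : ℕ => {n : ℕ | ((Denumerable.ofNat Nat.Partrec.Code e).eval n).Dom}ᶜ.Finite)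
        (fun c : ℕ => codesGraph (Denumerable.ofNat Nat.Partrec.Code c) ∧
          HasNonFinColorableComponent (codedGraph (Denumerable.ofNat Nat.Partrec.Code c))) := by
  obtain ⟨f, hf, hinj, heval⟩ := exists_rowGraph_code
  have hcodes := fun e => codesGraph_of_eval (heval e)
  have hiff := fun e => hasNonFinColorableComponent_codedGraph_iff (heval e)
  exact ⟨f, hf, hinj, fun e => ⟨hcodes e, hiff e⟩, f, hf, hinj,
    fun e => ⟨fun h => ⟨hcodes e, (hiff e).2 h⟩, fun h => (hiff e).1 h.2⟩⟩
end

section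
/- The set {c : ℕ | Nat.Partrec.Code.ofNat c codes a recursive tree that has an infinite path} is one-one reducible to the set {c : ℕ | Nat.Partrec.Code.ofNat c codes a recursive graph that admits a proper coloring with colors in ℕ in which some color is used on infinitely many vertices}. -/
/-- A code `c` codes a recursive tree if on (the code of) every finite sequence it converges
to `0` or `1`, and the sequences with value `1` are closed under initial segments. -/
def codesTree (c : Nat.Partrec.Code) : Prop :=
  (∀ l : List ℕ,
      c.eval (Encodable.encode l) = Part.some 0 ∨ c.eval (Encodable.encode l) = Part.some 1) ∧
  ∀ σ τ : List ℕ, c.eval (Encodable.encode τ) = Part.some 1 → σ <+: τ →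
    c.eval (Encodable.encode σ) = Part.some 1

/-- The tree coded by `c`: the set of finite sequences with value `1`. -/
def codedTree (c : Nat.Partrec.Code) : Set (List ℕ) :=
  {l : List ℕ | c.eval (Encodable.encode l) = Part.some 1}

open Nat.Partrec Encodable Denumerable

/-- Two finite sequences are comparable if one is an initial segment of the other. -/
def ComparableLists (l₁ l₂ : List ℕ) : Prop :=
  l₁ <+: l₂ ∨ l₂ <+: l₁

instance (l₁ l₂ : List ℕ) : Decidable (ComparableLists l₁ l₂) :=
  inferInstanceAs (Decidable (_ ∨ _))

theorem comparableLists_comm {l₁ l₂ : List ℕ} : ComparableLists l₁ l₂ ↔ ComparableLists l₂ l₁ :=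
  or_comm

/-- The status of the sequence numbered `m` with respect to `c`: `0` if it is rejected, `1` if it
is accepted together with its immediate predecessor, and `2` otherwise. -/
def nodeStatus (c : Code) (m : ℕ) : Part ℕ :=
  (c.eval m).bind fun a =>
    (c.eval (encode (ofNat (List ℕ) m).dropLast)).map fun b =>
      if a = 0 then 0 else if a = 1 ∧ b = 1 then 1 else 2

/-- The edge value between the sequences numbered `m` and `n`, whose statuses are `a` and `b`. -/
def edgeValue (m n a b : ℕ) : ℕ :=
  if 2 ≤ a ∨ 2 ≤ b then 2
  else if m = n then 0
  else if a = 1 ∧ b = 1 ∧ ComparableLists (ofNat (List ℕ) m) (ofNat (List ℕ) n) then 0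
  else 1

/-- The graph joining two distinct sequences unless both lie on the tree coded by `c` and are
comparable. -/
def incomparability (c : Code) (m n : ℕ) : Part ℕ :=
  (nodeStatus c m).bind fun a => (nodeStatus c n).map fun b => edgeValue m n a b

theorem edgeValue_comm (m n a b : ℕ) : edgeValue m n a b = edgeValue n m b a := by
  have := comparableLists_comm (l₁ := ofNat (List ℕ) m) (l₂ := ofNat (List ℕ) n)
  unfold edgeValue
  grind

theorem incomparability_comm (c : Code) (m n : ℕ) :
    incomparability c m n = incomparability c n m := by
  ext x
  simp only [incomparability, Part.mem_bind_iff, Part.mem_map_iff]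
  constructor <;>
  · rintro ⟨a, ha, b, hb, rfl⟩
    exact ⟨b, hb, a, ha, edgeValue_comm _ _ _ _⟩

theorem primrecRel_isPrefix : PrimrecRel fun l₁ l₂ : List ℕ => l₁ <+: l₂ :=
  (Primrec.eq.comp Primrec.fst
    (Primrec.list_take.comp (Primrec.list_length.comp Primrec.fst) Primrec.snd)).of_eq
    fun _ => List.prefix_iff_eq_take.symm

theorem primrecRel_comparableLists : PrimrecRel ComparableLists :=
  PrimrecPred.or primrecRel_isPrefix (primrecRel_isPrefix.comp Primrec.snd Primrec.fst)

theorem primrec_dropLast : Primrec (List.dropLast : List ℕ → List ℕ) :=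
  (Primrec.list_take.comp (Primrec.nat_sub.comp Primrec.list_length (Primrec.const 1))
    Primrec.id).of_eq fun l => (List.dropLast_eq_take (l := l)).symm

theorem primrec_edgeValue :
    Primrec fun p : (ℕ × ℕ) × ℕ × ℕ => edgeValue p.1.1 p.1.2 p.2.1 p.2.2 := by
  have hm : Primrec fun p : (ℕ × ℕ) × ℕ × ℕ => p.1.1 := Primrec.fst.comp Primrec.fst
  have hn : Primrec fun p : (ℕ × ℕ) × ℕ × ℕ => p.1.2 := Primrec.snd.comp Primrec.fst
  have ha : Primrec fun p : (ℕ × ℕ) × ℕ × ℕ => p.2.1 := Primrec.fst.comp Primrec.snd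
  have hb : Primrec fun p : (ℕ × ℕ) × ℕ × ℕ => p.2.2 := Primrec.snd.comp Primrec.snd
  refine Primrec.ite (.or (Primrec.nat_le.comp (.const 2) ha) (Primrec.nat_le.comp (.const 2) hb))
    (.const 2) (Primrec.ite (Primrec.eq.comp hm hn) (.const 0) (Primrec.ite
      (.and (Primrec.eq.comp ha (.const 1)) (.and (Primrec.eq.comp hb (.const 1)) ?_))
      (.const 0) (.const 1)))
  exact primrecRel_comparableLists.comp ((Primrec.ofNat _).comp hm) ((Primrec.ofNat _).comp hn)

theorem partrec_nodeStatus : Partrec₂ nodeStatus := by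
  have hb : Partrec fun p : (Code × ℕ) × ℕ =>
      p.1.1.eval (encode (ofNat (List ℕ) p.1.2).dropLast) :=
    Code.eval_part.comp (Computable.fst.comp Computable.fst)
      (Primrec.encode.comp (primrec_dropLast.comp
        ((Primrec.ofNat _).comp (Primrec.snd.comp Primrec.fst)))).to_comp
  have hv : Primrec fun p : ((Code × ℕ) × ℕ) × ℕ =>
      if p.1.2 = 0 then 0 else if p.1.2 = 1 ∧ p.2 = 1 then 1 else 2 :=
    Primrec.ite (Primrec.eq.comp (Primrec.snd.comp Primrec.fst) (.const 0)) (.const 0)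
      (Primrec.ite (.and (Primrec.eq.comp (Primrec.snd.comp Primrec.fst) (.const 1))
        (Primrec.eq.comp Primrec.snd (.const 1))) (.const 1) (.const 2))
  exact Partrec.bind Code.eval_part (hb.map hv.to_comp.to₂)

theorem partrec_incomparability :
    Partrec fun p : Code × ℕ × ℕ => incomparability p.1 p.2.1 p.2.2 := by
  have ha : Partrec fun p : Code × ℕ × ℕ => nodeStatus p.1 p.2.1 :=
    partrec_nodeStatus.comp Computable.fst (Computable.fst.comp Computable.snd)
  have hb : Partrec fun p : (Code × ℕ × ℕ) × ℕ => nodeStatus p.1.1 p.1.2.2 :=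
    partrec_nodeStatus.comp (Computable.fst.comp Computable.fst)
      (Computable.snd.comp (Computable.snd.comp Computable.fst))
  have hv : Primrec fun p : ((Code × ℕ × ℕ) × ℕ) × ℕ =>
      edgeValue p.1.1.2.1 p.1.1.2.2 p.1.2 p.2 :=
    primrec_edgeValue.comp (Primrec.pair
      (Primrec.snd.comp (Primrec.fst.comp Primrec.fst))
      (Primrec.pair (Primrec.snd.comp Primrec.fst) Primrec.snd))
  exact ha.bind (hb.map hv.to_comp.to₂)

/-- A computable injection sending each code to a code of its incomparability graph. -/
theorem exists_incomparability_reduction :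
    ∃ f : ℕ → ℕ, Computable f ∧ Function.Injective f ∧
      ∀ k m n, (ofNat Code (f k)).eval (Nat.pair m n) = incomparability (ofNat Code k) m n := by
  have h : Partrec fun x : ℕ =>
      incomparability (ofNat Code x.unpair.1) x.unpair.2.unpair.1 x.unpair.2.unpair.2 :=
    partrec_incomparability.comp (Primrec.pair
      ((Primrec.ofNat Code).comp (Primrec.fst.comp Primrec.unpair))
      (Primrec.unpair.comp (Primrec.snd.comp Primrec.unpair))).to_comp
  obtain ⟨G, hG⟩ := Code.exists_code.1 (Partrec.nat_iff.1 h)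
  refine ⟨fun k => encode (G.curry k), ?_, ?_, ?_⟩
  · exact (Primrec.encode.comp
      (Code.primrec₂_curry.comp (Primrec.const G) Primrec.id)).to_comp
  · intro a b hab
    exact (Code.curry_inj (encode_injective hab)).2
  · intro k m n
    simp [Code.eval_curry, hG]

theorem nodeStatus_of_codesTree {c : Code} (hc : codesTree c) (l : List ℕ) :
    (l ∈ codedTree c ∧ nodeStatus c (encode l) = Part.some 1) ∨
      (l ∉ codedTree c ∧ nodeStatus c (encode l) = Part.some 0) := by
  rcases hc.1 l with h | h
  · right
    rcases hc.1 l.dropLast with h' | h' <;> simp [codedTree, nodeStatus, h, h']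
  · left
    have h' := hc.2 _ _ h (List.dropLast_prefix l)
    simp [codedTree, nodeStatus, h, h']

theorem incomparability_of_codesTree {c : Code} (hc : codesTree c) (l₁ l₂ : List ℕ) :
    (incomparability c (encode l₁) (encode l₂) = Part.some 0 ∧
        (l₁ = l₂ ∨ (l₁ ∈ codedTree c ∧ l₂ ∈ codedTree c ∧ ComparableLists l₁ l₂))) ∨
      (incomparability c (encode l₁) (encode l₂) = Part.some 1 ∧
        ¬(l₁ = l₂ ∨ (l₁ ∈ codedTree c ∧ l₂ ∈ codedTree c ∧ ComparableLists l₁ l₂))) := by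
  rcases nodeStatus_of_codesTree hc l₁ with ⟨h₁, e₁⟩ | ⟨h₁, e₁⟩ <;>
  rcases nodeStatus_of_codesTree hc l₂ with ⟨h₂, e₂⟩ | ⟨h₂, e₂⟩ <;>
  simp only [incomparability, e₁, e₂, h₁, h₂, edgeValue, Part.bind_some, Part.map_some,
    Denumerable.ofNat_encode, encode_inj, Part.some_inj] <;> grind

theorem codesTree_of_nodeStatus {c : Code}
    (h : ∀ l : List ℕ, nodeStatus c (encode l) = Part.some 0 ∨
      nodeStatus c (encode l) = Part.some 1) : codesTree c := by
  have key : ∀ l : List ℕ, c.eval (encode l) = Part.some 0 ∨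
      (c.eval (encode l) = Part.some 1 ∧ c.eval (encode l.dropLast) = Part.some 1) := by
    intro l
    have h' : ∃ v < 2, v ∈ nodeStatus c (encode l) := by
      rcases h l with h | h <;> simp [h]
    obtain ⟨v, hv, hm⟩ := h'
    simp only [nodeStatus, Part.mem_bind_iff, Part.mem_map_iff, Denumerable.ofNat_encode] at hm
    obtain ⟨a, ha, b, hb, rfl⟩ := hm
    rw [Part.eq_some_iff, Part.eq_some_iff, Part.eq_some_iff]
    grind
  refine ⟨fun l => (key l).imp_right And.left, fun σ τ hτ hp => ?_⟩
  induction τ using List.reverseRecOn with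
  | nil => rwa [List.prefix_nil.1 hp]
  | append_singleton l a ih =>
    rcases List.prefix_concat_iff.1 hp with rfl | hp
    · exact hτ
    · rcases key (l ++ [a]) with h | h
      · simp [h, Part.some_inj] at hτ
      · exact ih (by simpa using h.2) hp

theorem nodeStatus_of_incomparability_self {c : Code} {m : ℕ}
    (h : incomparability c m m = Part.some 0) :
    nodeStatus c m = Part.some 0 ∨ nodeStatus c m = Part.some 1 := by
  have hm : 0 ∈ incomparability c m m := by simp [h]
  simp only [incomparability, Part.mem_bind_iff, Part.mem_map_iff] at hm
  obtain ⟨a, ha, b, hb, hab⟩ := hm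
  rw [Part.eq_some_iff, Part.eq_some_iff]
  have : a < 2 := by
    unfold edgeValue at hab
    grind
  interval_cases a <;> simp [ha]

theorem codesGraph_iff_codesTree {c g : Code}
    (hg : ∀ m n, g.eval (Nat.pair m n) = incomparability c m n) :
    codesGraph g ↔ codesTree c := by
  constructor
  · intro h
    refine codesTree_of_nodeStatus fun l => nodeStatus_of_incomparability_self ?_
    rw [← hg]
    exact (h _ _).2.2 rfl
  · intro h m n
    simp only [hg]
    have key := incomparability_of_codesTree h (ofNat (List ℕ) m) (ofNat (List ℕ) n)
    simp only [Denumerable.encode_ofNat] at key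
    refine ⟨key.imp And.left And.left, incomparability_comm _ _ _, ?_⟩
    rintro rfl
    simpa using key

theorem codedGraph_adj_iff_s7 {c g : Code}
    (hg : ∀ m n, g.eval (Nat.pair m n) = incomparability c m n) (hc : codesTree c)
    (l₁ l₂ : List ℕ) :
    (codedGraph g).Adj (encode l₁) (encode l₂) ↔
      l₁ ≠ l₂ ∧ ¬(l₁ ∈ codedTree c ∧ l₂ ∈ codedTree c ∧ ComparableLists l₁ l₂) := by
  simp only [codedGraph, SimpleGraph.fromRel_adj, hg, incomparability_comm c (encode l₂), or_self,
    ne_eq, encode_inj]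
  rcases incomparability_of_codesTree hc l₁ l₂ with ⟨h, h'⟩ | ⟨h, h'⟩ <;>
  simp only [h, Part.some_inj] <;> grind

theorem ComparableLists.isPrefix_of_length_le {l₁ l₂ : List ℕ} (h : ComparableLists l₁ l₂)
    (hl : l₁.length ≤ l₂.length) : l₁ <+: l₂ := by
  rcases h with h | h
  · exact h
  · rw [h.eq_of_length_le hl]

/-- The union of an infinite chain of finite sequences is an infinite sequence. -/
theorem exists_path_of_infinite_chain {S : Set (List ℕ)} (hS : S.Infinite)
    (hc : ∀ l₁ ∈ S, ∀ l₂ ∈ S, ComparableLists l₁ l₂) :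
    ∃ f : ℕ → ℕ, ∀ n, ∃ l ∈ S, (List.range n).map f <+: l := by
  have hinj : Set.InjOn List.length S := fun l₁ h₁ l₂ h₂ hl =>
    ((hc l₁ h₁ l₂ h₂).isPrefix_of_length_le hl.le).eq_of_length hl
  have hlong : ∀ n, ∃ l ∈ S, n < l.length := fun n => by
    obtain ⟨_, ⟨l, hl, rfl⟩, hn⟩ := (hS.image hinj).exists_gt n
    exact ⟨l, hl, hn⟩
  choose s hsS hs using hlong
  refine ⟨fun n => (s n)[n]'(hs n), fun n => ⟨s n, hsS n, ?_⟩⟩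
  rw [List.prefix_iff_getElem]
  refine ⟨by simpa using (hs n).le, fun i hi => ?_⟩
  simp only [List.getElem_map, List.getElem_range]
  rcases hc _ (hsS i) _ (hsS n) with h | h
  · exact h.getElem _
  · exact (h.getElem _).symm

theorem map_range_isPrefix (f : ℕ → ℕ) {m n : ℕ} (h : m ≤ n) :
    (List.range m).map f <+: (List.range n).map f := by
  obtain ⟨k, rfl⟩ := Nat.exists_eq_add_of_le h
  rw [List.range_add, List.map_append]
  exact List.prefix_append _ _

theorem exists_path_iff_exists_coloring {c g : Code}
    (hg : ∀ m n, g.eval (Nat.pair m n) = incomparability c m n) (hc : codesTree c) :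
    (∃ f : ℕ → ℕ, ∀ n, (List.range n).map f ∈ codedTree c) ↔
      ∃ χ : ℕ → ℕ, (∀ m n : ℕ, (codedGraph g).Adj m n → χ m ≠ χ n) ∧
        ∃ k : ℕ, {v : ℕ | χ v = k}.Infinite := by
  constructor
  · rintro ⟨f, hf⟩
    let P : Set ℕ := Set.range fun n => encode ((List.range n).map f)
    have hP : P.Infinite := by
      refine Set.infinite_range_of_injective fun a b hab => ?_
      simpa using congrArg List.length (encode_injective hab)
    classical
    refine ⟨fun v => if v ∈ P then 0 else v + 1, fun m n hmn heq => ?_, 0, ?_⟩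
    · have hne := hmn.ne
      by_cases hm : m ∈ P <;> by_cases hn : n ∈ P <;> simp [hm, hn, hne] at heq
      obtain ⟨i, rfl⟩ := hm
      obtain ⟨j, rfl⟩ := hn
      exact ((codedGraph_adj_iff_s7 hg hc _ _).1 hmn).2
        ⟨hf i, hf j, (le_total i j).imp (map_range_isPrefix f) (map_range_isPrefix f)⟩
    · refine hP.mono fun v hv => ?_
      simp [hv]
  · rintro ⟨χ, hχ, k, hk⟩
    let S : Set (List ℕ) := {l | χ (encode l) = k}
    have hS : S.Infinite := by
      refine fun hfin => hk ((hfin.image encode).subset fun v hv => ⟨ofNat (List ℕ) v, ?_, ?_⟩)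
      · simpa [S] using hv
      · simp
    have key : ∀ l₁ ∈ S, ∀ l₂ ∈ S, l₁ ≠ l₂ →
        l₁ ∈ codedTree c ∧ l₂ ∈ codedTree c ∧ ComparableLists l₁ l₂ := by
      intro l₁ h₁ l₂ h₂ hne
      by_contra h
      exact hχ _ _ ((codedGraph_adj_iff_s7 hg hc l₁ l₂).2 ⟨hne, h⟩) (h₁.trans h₂.symm)
    obtain ⟨f, hf⟩ := exists_path_of_infinite_chain hS fun l₁ h₁ l₂ h₂ => by
      by_cases h : l₁ = l₂
      · exact h ▸ Or.inl (List.prefix_refl _)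
      · exact (key l₁ h₁ l₂ h₂ h).2.2
    refine ⟨f, fun n => ?_⟩
    obtain ⟨l, hl, hp⟩ := hf n
    obtain ⟨l', hl', hne⟩ := hS.nontrivial.exists_ne l
    exact hc.2 _ _ (key l hl l' hl' hne.symm).1 hp

theorem stmt7 :
    OneOneReducible
      (fun c : ℕ => codesTree (Denumerable.ofNat Nat.Partrec.Code c) ∧
        ∃ f : ℕ → ℕ, ∀ n : ℕ,
          (List.range n).map f ∈ codedTree (Denumerable.ofNat Nat.Partrec.Code c))
      (fun c : ℕ => codesGraph (Denumerable.ofNat Nat.Partrec.Code c) ∧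
        ∃ χ : ℕ → ℕ,
          (∀ m n : ℕ, (codedGraph (Denumerable.ofNat Nat.Partrec.Code c)).Adj m n → χ m ≠ χ n) ∧
          ∃ k : ℕ, {v : ℕ | χ v = k}.Infinite) := by
  obtain ⟨f, hf, hinj, heval⟩ := exists_incomparability_reduction
  refine ⟨f, hf, hinj, fun k => ?_⟩
  beta_reduce
  rw [codesGraph_iff_codesTree (heval k)]
  exact and_congr_right fun hc => exists_path_iff_exists_coloring (heval k) hc
end

section
/- Let H be the simple graph on ℕ with edges {n, n+1} for every n and the additional edge {0, 2} (an infinite ray with a triangle attached at one end). Let T be a tree, and let G_T be the simple graph on Fin 3 ⊕ List ℕ in which: the three vertices of Fin 3 are pairwise adjacent; the vertex (inl 0) is adjacent to (inr []); and (inr σ) is adjacent to (inr τ) if and only if σ ∈ T, τ ∈ T, and one of σ, τ is obtained from the other by appending a single element. Then there exists an injective graph homomorphism from H into G_T if and only if T has an infinite path. -/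
/-- A tree: a set of finite sequences of naturals closed under initial segments. -/
def IsTree (T : Set (List ℕ)) : Prop :=
  ∀ ⦃σ τ : List ℕ⦄, τ ∈ T → σ <+: τ → σ ∈ T

/-- The infinite ray with a triangle attached at one end: edges `{n, n+1}` and `{0, 2}`. -/
def H9 : SimpleGraph ℕ :=
  SimpleGraph.fromRel (fun m n => n = m + 1 ∨ (m = 0 ∧ n = 2))

/-- Base relation of `G_T`: the three `Fin 3` vertices pairwise adjacent, `inl 0` adjacent to
`inr []`, and `inr σ ~ inr τ` iff both are in `T` and one extends the other by one element. -/
def rel9 (T : Set (List ℕ)) : Fin 3 ⊕ List ℕ → Fin 3 ⊕ List ℕ → Prop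
  | Sum.inl _, Sum.inl _ => True
  | Sum.inl i, Sum.inr σ => i = 0 ∧ σ = []
  | Sum.inr σ, Sum.inr τ => σ ∈ T ∧ τ ∈ T ∧ ∃ m : ℕ, τ = σ ++ [m]
  | _, _ => False

/-- The graph `G_T`. -/
def G9 (T : Set (List ℕ)) : SimpleGraph (Fin 3 ⊕ List ℕ) :=
  SimpleGraph.fromRel (rel9 T)

theorem G9_adj_inl_inr {T : Set (List ℕ)} {i : Fin 3} {σ : List ℕ} :
    (G9 T).Adj (Sum.inl i) (Sum.inr σ) ↔ i = 0 ∧ σ = [] := by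
  simp [G9, rel9]

theorem G9_adj_inr_inr {T : Set (List ℕ)} {σ τ : List ℕ} :
    (G9 T).Adj (Sum.inr σ) (Sum.inr τ) ↔
      σ ∈ T ∧ τ ∈ T ∧ ((∃ m, τ = σ ++ [m]) ∨ ∃ m, σ = τ ++ [m]) := by
  simp only [G9, rel9, SimpleGraph.fromRel_adj]
  constructor
  · tauto
  · rintro ⟨hσ, hτ, h⟩
    refine ⟨?_, by tauto⟩
    rintro h'
    obtain rfl := Sum.inr_injective h'
    simp at h

theorem G9_adj_inl_inl {T : Set (List ℕ)} {i j : Fin 3} :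
    (G9 T).Adj (Sum.inl i) (Sum.inl j) ↔ i ≠ j := by
  simp [G9, rel9]

theorem length_of_G9_adj {T : Set (List ℕ)} {σ τ : List ℕ}
    (h : (G9 T).Adj (Sum.inr σ) (Sum.inr τ)) :
    τ.length = σ.length + 1 ∨ σ.length = τ.length + 1 := by
  obtain ⟨-, -, ⟨m, rfl⟩ | ⟨m, rfl⟩⟩ := G9_adj_inr_inr.1 h <;> simp

/-- Every vertex of a triangle of `G9 T` lies in the attached triangle. -/
theorem exists_eq_inl_of_triangle {T : Set (List ℕ)} {x y z : Fin 3 ⊕ List ℕ}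
    (hxy : (G9 T).Adj x y) (hyz : (G9 T).Adj y z) (hxz : (G9 T).Adj x z) :
    ∃ i, x = Sum.inl i := by
  rcases x with i | σ
  · exact ⟨i, rfl⟩
  exfalso
  rcases y with i | τ <;> rcases z with j | ρ
  · have h1 := G9_adj_inl_inr.1 hxy.symm
    have h2 := G9_adj_inl_inr.1 hxz.symm
    exact G9_adj_inl_inl.1 hyz (h1.1.trans h2.1.symm)
  · have h1 := G9_adj_inl_inr.1 hxy.symm
    have h2 := G9_adj_inl_inr.1 hyz
    exact hxz.ne (by rw [h1.2, h2.2])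
  · have h1 := G9_adj_inl_inr.1 hxz.symm
    have h2 := G9_adj_inl_inr.1 hyz.symm
    exact hxy.ne (by rw [h1.2, h2.2])
  · have h1 := length_of_G9_adj hxy
    have h2 := length_of_G9_adj hyz
    have h3 := length_of_G9_adj hxz
    omega

theorem H9_adj_succ (n : ℕ) : H9.Adj n (n + 1) := by
  simp [H9]

theorem H9_adj_zero_two : H9.Adj 0 2 := by
  simp [H9]

theorem exists_path_of_hom {T : Set (List ℕ)} (φ : H9 →g G9 T) (hφ : Function.Injective φ) :
    ∃ f : ℕ → ℕ, ∀ n : ℕ, (List.range n).map f ∈ T := by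
  have h01 := φ.map_adj (H9_adj_succ 0)
  have h12 := φ.map_adj (H9_adj_succ 1)
  have h02 := φ.map_adj H9_adj_zero_two
  obtain ⟨a, ha⟩ := exists_eq_inl_of_triangle h01 h12 h02
  obtain ⟨b, hb⟩ := exists_eq_inl_of_triangle h12 h02.symm h01.symm
  obtain ⟨c, hc⟩ := exists_eq_inl_of_triangle h02.symm h01 h12.symm
  have hinr (n : ℕ) : ∃ σ, φ (n + 3) = Sum.inr σ := by
    rcases hd : φ (n + 3) with d | σ
    · have hne {k l : ℕ} {i j : Fin 3} (hk : φ k = Sum.inl i) (hl : φ l = Sum.inl j)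
          (hkl : k ≠ l) : i ≠ j := by
        rintro rfl
        exact hkl (hφ (hk.trans hl.symm))
      have := hne ha hb (by omega)
      have := hne ha hc (by omega)
      have := hne hb hc (by omega)
      have := hne ha hd (by omega)
      have := hne hb hd (by omega)
      have := hne hc hd (by omega)
      omega
    · exact ⟨σ, rfl⟩
  choose s hs using hinr
  have hs0 : s 0 = [] := by
    have h := φ.map_adj (H9_adj_succ 2)
    rw [hc, hs 0] at h
    exact (G9_adj_inl_inr.1 h).2
  have hadj (n : ℕ) : (G9 T).Adj (Sum.inr (s n)) (Sum.inr (s (n + 1))) := by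
    have h := φ.map_adj (H9_adj_succ (n + 3))
    rwa [hs n, show n + 3 + 1 = (n + 1) + 3 by omega, hs (n + 1)] at h
  have hstep (n : ℕ) : ∃ m, s (n + 1) = s n ++ [m] := by
    induction n with
    | zero =>
      obtain ⟨-, -, h | ⟨m, hm⟩⟩ := G9_adj_inr_inr.1 (hadj 0)
      · exact h
      · simp [hs0] at hm
    | succ n ih =>
      obtain ⟨-, -, h | ⟨m, hm⟩⟩ := G9_adj_inr_inr.1 (hadj (n + 1))
      · exact h
      · obtain ⟨k, hk⟩ := ih
        have heq : s n = s (n + 1 + 1) := (List.append_inj' (hk.symm.trans hm) rfl).1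
        have := hφ ((hs n).trans ((congrArg Sum.inr heq).trans (hs (n + 1 + 1)).symm))
        omega
  choose f hf using hstep
  refine ⟨f, fun n => ?_⟩
  have hmap : (List.range n).map f = s n := by
    induction n with
    | zero => simp [hs0]
    | succ n ih => rw [List.range_succ, List.map_append, ih, hf]; rfl
  rw [hmap]
  exact (G9_adj_inr_inr.1 (hadj n)).1

/-- The vertex map of `H9` into `G9 T` that follows the branch `f` after the triangle. -/
def branchEmbedding (f : ℕ → ℕ) : ℕ → Fin 3 ⊕ List ℕ
  | 0 => Sum.inl 1
  | 1 => Sum.inl 2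
  | 2 => Sum.inl 0
  | n + 3 => Sum.inr ((List.range n).map f)

theorem branchEmbedding_injective (f : ℕ → ℕ) : Function.Injective (branchEmbedding f) := by
  intro m n h
  rcases m with _ | _ | _ | m <;> rcases n with _ | _ | _ | n <;>
    simp [branchEmbedding] at h ⊢
  simpa using congrArg List.length h

theorem branchEmbedding_adj_succ {T : Set (List ℕ)} {f : ℕ → ℕ}
    (hf : ∀ n : ℕ, (List.range n).map f ∈ T) (n : ℕ) :
    (G9 T).Adj (branchEmbedding f n) (branchEmbedding f (n + 1)) := by
  rcases n with _ | _ | _ | n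
  · exact G9_adj_inl_inl.2 (by decide)
  · exact G9_adj_inl_inl.2 (by decide)
  · exact G9_adj_inl_inr.2 ⟨rfl, rfl⟩
  · exact G9_adj_inr_inr.2 ⟨hf n, hf (n + 1), Or.inl ⟨f n, by simp [List.range_succ]⟩⟩

theorem branchEmbedding_adj {T : Set (List ℕ)} {f : ℕ → ℕ}
    (hf : ∀ n : ℕ, (List.range n).map f ∈ T) {m n : ℕ} (h : H9.Adj m n) :
    (G9 T).Adj (branchEmbedding f m) (branchEmbedding f n) := by
  have h02 : (G9 T).Adj (branchEmbedding f 0) (branchEmbedding f 2) :=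
    G9_adj_inl_inl.2 (by decide)
  rw [H9, SimpleGraph.fromRel_adj] at h
  obtain ⟨-, (rfl | ⟨rfl, rfl⟩) | (rfl | ⟨rfl, rfl⟩)⟩ := h
  · exact branchEmbedding_adj_succ hf m
  · exact h02
  · exact (branchEmbedding_adj_succ hf n).symm
  · exact h02.symm

theorem stmt9 (T : Set (List ℕ)) (hT : IsTree T) :
    (∃ φ : H9 →g G9 T, Function.Injective φ) ↔
    ∃ f : ℕ → ℕ, ∀ n : ℕ, (List.range n).map f ∈ T := by
  constructor
  · rintro ⟨φ, hφ⟩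
    exact exists_path_of_hom φ hφ
  · rintro ⟨f, hf⟩
    exact ⟨⟨branchEmbedding f, branchEmbedding_adj hf⟩, branchEmbedding_injective f⟩
end

section
/- Let H be the simple graph on ℕ with edges {n, n+1} for every n and the additional edge {0, 2}. Then the set {c : ℕ | Nat.Partrec.Code.ofNat c codes a recursive tree that has an infinite path} is one-one reducible to the set {c : ℕ | Nat.Partrec.Code.ofNat c codes a recursive graph into which there is an injective graph homomorphism from H}. -/
open Nat.Partrec (Code)

namespace TreeToGraph

/-- The sequence represented, in reversed order, by the vertex `x ≥ 2`. -/
def seq (x : ℕ) : List ℕ := Denumerable.ofNat (List ℕ) (x - 2)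

/-- The vertex `m` represents the parent of the sequence represented by `n`. -/
def IsParent (m n : ℕ) : Prop := 2 < n ∧ Encodable.encode (seq n).tail + 2 = m

instance : DecidableRel IsParent := fun _ _ => inferInstanceAs (Decidable (_ ∧ _))

/-- Adjacency of `m` and `n`, where `a` and `b` equal `1` exactly when the sequences represented by
`m` and `n` belong to the tree; the vertices `0`, `1` and the root `2` form a triangle. -/
def Edge (m n a b : ℕ) : Prop :=
  (m ≠ n ∧ m < 3 ∧ n < 3) ∨ (a = 1 ∧ b = 1 ∧ (IsParent m n ∨ IsParent n m))

instance (m n a b : ℕ) : Decidable (Edge m n a b) := inferInstanceAs (Decidable (_ ∨ _))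

/-- The value at a node with value `a` whose parent has value `p`; the result `2` signals that
the tree conditions are violated there. -/
def localValue (a p : ℕ) : ℕ := if a = 0 ∨ (a = 1 ∧ p = 1) then a else 2

/-- The value of the graph at `(m, n)`, given the local values at `m` and `n`. -/
def edgeValue (m n a b : ℕ) : ℕ :=
  if a = 2 ∨ b = 2 then 2 else if Edge m n a b then 1 else 0

/-- The local value at the vertex `x`, computed by running `c`. -/
def nodeValue (c : Code) (x : ℕ) : Part ℕ :=
  (c.eval (Encodable.encode (seq x).reverse)).bind fun a =>
    (c.eval (Encodable.encode (seq x).tail.reverse)).map fun p => localValue a p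

/-- The characteristic function of the graph associated with the tree coded by `c`. -/
def graphValue (c : Code) (m n : ℕ) : Part ℕ :=
  (nodeValue c m).bind fun a => (nodeValue c n).map fun b => edgeValue m n a b

lemma primrec_seq : Primrec seq :=
  (Primrec.ofNat (List ℕ)).comp (Primrec.nat_sub.comp Primrec.id (Primrec.const 2))

lemma primrec_localValue : Primrec₂ localValue := by
  have hc (k : ℕ) {f : ℕ × ℕ → ℕ} (hf : Primrec f) : PrimrecPred fun x => f x = k :=
    Primrec.eq.comp hf (Primrec.const k)
  exact Primrec.ite ((hc 0 Primrec.fst).or ((hc 1 Primrec.fst).and (hc 1 Primrec.snd)))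
    Primrec.fst (Primrec.const 2)

lemma primrecRel_isParent : PrimrecRel IsParent :=
  (Primrec.nat_lt.comp (Primrec.const 2) Primrec.snd).and
    (Primrec.eq.comp
      (Primrec.nat_add.comp
        (Primrec.encode.comp (Primrec.list_tail.comp (primrec_seq.comp Primrec.snd)))
        (Primrec.const 2))
      Primrec.fst)

lemma primrec_edgeValue :
    Primrec fun x : (ℕ × ℕ) × (ℕ × ℕ) => edgeValue x.1.1 x.1.2 x.2.1 x.2.2 := by
  have hm : Primrec fun x : (ℕ × ℕ) × (ℕ × ℕ) => x.1.1 := Primrec.fst.comp Primrec.fst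
  have hn : Primrec fun x : (ℕ × ℕ) × (ℕ × ℕ) => x.1.2 := Primrec.snd.comp Primrec.fst
  have ha : Primrec fun x : (ℕ × ℕ) × (ℕ × ℕ) => x.2.1 := Primrec.fst.comp Primrec.snd
  have hb : Primrec fun x : (ℕ × ℕ) × (ℕ × ℕ) => x.2.2 := Primrec.snd.comp Primrec.snd
  have hc (k : ℕ) {f : (ℕ × ℕ) × (ℕ × ℕ) → ℕ} (hf : Primrec f) :
      PrimrecPred fun x => f x = k := Primrec.eq.comp hf (Primrec.const k)
  have hl {f : (ℕ × ℕ) × (ℕ × ℕ) → ℕ} (hf : Primrec f) :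
      PrimrecPred fun x => f x < 3 := Primrec.nat_lt.comp hf (Primrec.const 3)
  have hE : PrimrecPred fun x : (ℕ × ℕ) × (ℕ × ℕ) => Edge x.1.1 x.1.2 x.2.1 x.2.2 :=
    ((Primrec.eq.comp hm hn).not.and ((hl hm).and (hl hn))).or
      ((hc 1 ha).and ((hc 1 hb).and
        ((primrecRel_isParent.comp hm hn).or (primrecRel_isParent.comp hn hm))))
  exact Primrec.ite ((hc 2 ha).or (hc 2 hb)) (Primrec.const 2)
    (Primrec.ite hE (Primrec.const 1) (Primrec.const 0))

lemma partrec_nodeValue : Partrec₂ nodeValue := by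
  have h1 : Partrec fun x : Code × ℕ => x.1.eval (Encodable.encode (seq x.2).reverse) :=
    Code.eval_part.comp Computable.fst (Primrec.encode.comp
      (Primrec.list_reverse.comp (primrec_seq.comp Primrec.snd))).to_comp
  have h2 : Partrec fun x : Code × ℕ => x.1.eval (Encodable.encode (seq x.2).tail.reverse) :=
    Code.eval_part.comp Computable.fst (Primrec.encode.comp
      (Primrec.list_reverse.comp (Primrec.list_tail.comp (primrec_seq.comp Primrec.snd)))).to_comp
  have h3 : Partrec₂ fun (x : Code × ℕ) (a : ℕ) =>
      (x.1.eval (Encodable.encode (seq x.2).tail.reverse)).map fun p => localValue a p :=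
    Partrec.map (h2.comp Computable.fst) (primrec_localValue.to_comp.comp
      (Computable.snd.comp Computable.fst) Computable.snd)
  exact h1.bind h3

lemma partrec_bind_map {α : Type*} [Primcodable α] {v : α → ℕ → Part ℕ} (hv : Partrec₂ v)
    {e : (ℕ × ℕ) × (ℕ × ℕ) → ℕ} (he : Computable e) :
    Partrec fun x : α × (ℕ × ℕ) =>
      (v x.1 x.2.1).bind fun a => (v x.1 x.2.2).map fun b => e (x.2, (a, b)) := by
  have h1 : Partrec fun x : α × (ℕ × ℕ) => v x.1 x.2.1 :=
    hv.comp Computable.fst (Computable.fst.comp Computable.snd)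
  have h2 : Partrec fun x : α × (ℕ × ℕ) => v x.1 x.2.2 :=
    hv.comp Computable.fst (Computable.snd.comp Computable.snd)
  have hp : Computable fun y : ((α × (ℕ × ℕ)) × ℕ) × ℕ => (y.1.1.2, (y.1.2, y.2)) :=
    Computable.pair (Computable.snd.comp (Computable.fst.comp Computable.fst))
      (Computable.pair (Computable.snd.comp Computable.fst) Computable.snd)
  have h3 : Partrec₂ fun (x : α × (ℕ × ℕ)) (a : ℕ) =>
      (v x.1 x.2.2).map fun b => e (x.2, (a, b)) :=
    Partrec.map (h2.comp Computable.fst) (he.comp hp)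
  exact h1.bind h3

lemma partrec_graphValue : Partrec fun x : Code × (ℕ × ℕ) => graphValue x.1 x.2.1 x.2.2 := by
  have h := partrec_bind_map partrec_nodeValue primrec_edgeValue.to_comp
  exact h

/-- There is an injective computable map sending codes of trees to codes of their graphs. -/
lemma exists_reduction : ∃ f : ℕ → ℕ, Computable f ∧ Function.Injective f ∧
    ∀ c m n : ℕ, (Denumerable.ofNat Code (f c)).eval (Nat.pair m n) =
      graphValue (Denumerable.ofNat Code c) m n := by
  have hg : Partrec fun x : ℕ => graphValue (Denumerable.ofNat Code x.unpair.1)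
      x.unpair.2.unpair.1 x.unpair.2.unpair.2 := by
    have hu := Primrec.unpair
    have hp : Primrec fun x : ℕ => (Denumerable.ofNat Code x.unpair.1, x.unpair.2.unpair) :=
      ((Primrec.ofNat Code).comp (Primrec.fst.comp hu)).pair (hu.comp (Primrec.snd.comp hu))
    exact partrec_graphValue.comp hp.to_comp
  obtain ⟨k, hk⟩ := Code.exists_code.1 (Partrec.nat_iff.1 hg)
  refine ⟨fun c => Encodable.encode (k.curry c), ?_, ?_, ?_⟩
  · exact (Primrec.encode.comp
      (Code.primrec₂_curry.comp (Primrec.const k) Primrec.id)).to_comp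
  · intro a b h
    exact (Code.curry_inj (Encodable.encode_injective h)).2
  · intro c m n
    rw [Denumerable.ofNat_encode, Code.eval_curry, hk]
    simp

lemma encode_seq (x : ℕ) : Encodable.encode (seq x) = x - 2 := by
  simp [seq]

lemma seq_encode (l : List ℕ) : seq (Encodable.encode l + 2) = l := by
  simp [seq]

lemma isParent_iff {m n : ℕ} :
    IsParent m n ↔ 2 ≤ m ∧ 2 ≤ n ∧ ∃ a, seq n = a :: seq m := by
  constructor
  · rintro ⟨h, rfl⟩
    refine ⟨by omega, by omega, ?_⟩
    rw [seq_encode]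
    cases hs : seq n with
    | nil =>
      have := encode_seq n
      rw [hs] at this
      simp at this
      omega
    | cons a l => exact ⟨a, rfl⟩
  · rintro ⟨hm, hn, a, h⟩
    have h1 := encode_seq n
    have h2 := encode_seq m
    rw [h, Encodable.encode_list_cons] at h1
    refine ⟨by omega, ?_⟩
    rw [h, List.tail_cons]
    omega

lemma nodeValue_of_codesTree {c : Code} (hc : codesTree c) (x : ℕ) :
    ∃ a, nodeValue c x = Part.some a ∧ a < 2 ∧ (a = 1 ↔ (seq x).reverse ∈ codedTree c) := by
  have htail : (seq x).tail.reverse <+: (seq x).reverse :=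
    (List.tail_suffix _).reverse
  unfold nodeValue codedTree
  rcases hc.1 (seq x).reverse with h | h
  · rcases hc.1 (seq x).tail.reverse with h' | h' <;>
      exact ⟨0, by simp [h, h', localValue], by simp, by simp [h]⟩
  · exact ⟨1, by simp [h, hc.2 _ _ h htail, localValue], by simp, by simp [h]⟩

lemma codesTree_of_nodeValue {c : Code} (hc : ∀ x, ∃ a, a ≠ 2 ∧ a ∈ nodeValue c x) :
    codesTree c := by
  have key (l : List ℕ) : (c.eval (Encodable.encode l.reverse) = Part.some 0 ∨
      c.eval (Encodable.encode l.reverse) = Part.some 1) ∧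
      (c.eval (Encodable.encode l.reverse) = Part.some 1 →
        c.eval (Encodable.encode l.tail.reverse) = Part.some 1) := by
    obtain ⟨v, hv, h⟩ := hc (Encodable.encode l + 2)
    rw [nodeValue, seq_encode] at h
    obtain ⟨a, ha, h⟩ := Part.mem_bind_iff.1 h
    obtain ⟨p, hp, rfl⟩ := (Part.mem_map_iff _).1 h
    rw [Part.eq_some_iff.2 ha, Part.eq_some_iff.2 hp]
    simp only [Part.some_inj]
    unfold localValue at hv
    split_ifs at hv <;> omega
  refine ⟨fun l => by simpa using (key l.reverse).1, ?_⟩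
  intro σ τ hτ hσ
  obtain ⟨ρ, rfl⟩ := hσ
  induction ρ using List.reverseRecOn with
  | nil => simpa using hτ
  | append_singleton ρ a ih =>
    refine ih ?_
    simpa using (key (σ ++ (ρ ++ [a])).reverse).2 (by simpa using hτ)

/-- Adjacency in the graph associated with the set of sequences `T`. -/
def TreeAdj (T : Set (List ℕ)) (m n : ℕ) : Prop :=
  (m ≠ n ∧ m < 3 ∧ n < 3) ∨
    ((seq m).reverse ∈ T ∧ (seq n).reverse ∈ T ∧ (IsParent m n ∨ IsParent n m))

lemma TreeAdj.symm {T : Set (List ℕ)} {m n : ℕ} (h : TreeAdj T m n) : TreeAdj T n m := by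
  unfold TreeAdj at *
  tauto

lemma TreeAdj.ne {T : Set (List ℕ)} {m n : ℕ} (h : TreeAdj T m n) : m ≠ n := by
  rintro rfl
  rcases h with h | ⟨-, -, h⟩
  · exact h.1 rfl
  · rw [or_self, isParent_iff] at h
    obtain ⟨-, -, a, h⟩ := h
    simpa using congrArg List.length h

open Classical in
lemma graphValue_of_codesTree {c : Code} (hc : codesTree c) (m n : ℕ) :
    graphValue c m n = Part.some (if TreeAdj (codedTree c) m n then 1 else 0) := by
  obtain ⟨a, ha, ha', haT⟩ := nodeValue_of_codesTree hc m
  obtain ⟨b, hb, hb', hbT⟩ := nodeValue_of_codesTree hc n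
  have hab : ¬(a = 2 ∨ b = 2) := by omega
  simp [graphValue, ha, hb, edgeValue, hab, Edge, TreeAdj, haT, hbT]
  congr

lemma codesTree_of_codesGraph {c d : Code} (h : ∀ m n, d.eval (Nat.pair m n) = graphValue c m n)
    (hd : codesGraph d) : codesTree c := by
  refine codesTree_of_nodeValue fun x => ?_
  have hx := (hd x x).2.2 rfl
  rw [h, Part.eq_some_iff, graphValue] at hx
  obtain ⟨a, ha, hx⟩ := Part.mem_bind_iff.1 hx
  obtain ⟨b, hb, hx⟩ := (Part.mem_map_iff _).1 hx
  refine ⟨a, ?_, ha⟩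
  rintro rfl
  simp [edgeValue] at hx

lemma codesGraph_of_codesTree {c d : Code} (h : ∀ m n, d.eval (Nat.pair m n) = graphValue c m n)
    (hc : codesTree c) : codesGraph d := by
  intro m n
  rw [h, h, graphValue_of_codesTree hc, graphValue_of_codesTree hc]
  have hs : TreeAdj (codedTree c) m n ↔ TreeAdj (codedTree c) n m := ⟨.symm, .symm⟩
  refine ⟨?_, by congr 2; exact propext hs, fun hmn => ?_⟩
  · split_ifs <;> simp
  · rw [if_neg fun hh => hh.ne hmn]

lemma codedGraph_adj {c d : Code} (h : ∀ m n, d.eval (Nat.pair m n) = graphValue c m n)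
    (hc : codesTree c) (m n : ℕ) :
    (codedGraph d).Adj m n ↔ TreeAdj (codedTree c) m n := by
  have hs : TreeAdj (codedTree c) m n ↔ TreeAdj (codedTree c) n m := ⟨.symm, .symm⟩
  simp only [codedGraph, SimpleGraph.fromRel_adj, h, graphValue_of_codesTree hc, Part.some_inj,
    ite_eq_left_iff, zero_ne_one, imp_false, not_not, ← hs, or_self]
  exact ⟨And.right, fun hh => ⟨hh.ne, hh⟩⟩

/-- The vertices traversed along the path `f`, preceded by the triangle vertices `0` and `1`. -/
def ray (f : ℕ → ℕ) : ℕ → ℕ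
  | 0 => 0
  | 1 => 1
  | n + 2 => Encodable.encode ((List.range n).map f).reverse + 2

lemma ray_injective (f : ℕ → ℕ) : Function.Injective (ray f) := by
  rintro (_ | _ | m) (_ | _ | n) h <;> simp [ray] at h <;> try rfl
  simpa using congrArg List.length h

lemma treeAdj_ray {T : Set (List ℕ)} {f : ℕ → ℕ} (hf : ∀ n, (List.range n).map f ∈ T) (n : ℕ) :
    TreeAdj T (ray f n) (ray f (n + 1)) := by
  match n with
  | 0 => exact Or.inl (by simp [ray])
  | 1 => exact Or.inl (by simp [ray])
  | n + 2 =>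
    refine Or.inr ⟨?_, ?_, Or.inl (isParent_iff.2 ⟨?_, ?_, f n, ?_⟩)⟩
    · simpa [ray, seq_encode] using hf n
    · simpa [ray, seq_encode, -List.map_reverse] using hf (n + 1)
    · simp [ray]
    · simp [ray]
    · simp only [ray, seq_encode, List.range_succ, List.map_append, List.map_cons, List.map_nil,
        List.reverse_append, List.reverse_singleton, List.singleton_append]

lemma exists_path_of_injective {T : Set (List ℕ)} {φ : ℕ → ℕ} (hφ : Function.Injective φ)
    (hstep : ∀ n, TreeAdj T (φ n) (φ (n + 1))) (h02 : TreeAdj T (φ 0) (φ 2)) :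
    ∃ f : ℕ → ℕ, ∀ n, (List.range n).map f ∈ T := by
  have small {m n : ℕ} (h : TreeAdj T m n) (hm : m < 2) : n < 3 := by
    rcases h with h | ⟨-, -, h | h⟩
    · exact h.2.2
    · have := (isParent_iff.1 h).1
      omega
    · have := (isParent_iff.1 h).2.1
      omega
  have parity {m n : ℕ} (h : TreeAdj T m n) : (m < 3 ∧ n < 3) ∨
      (seq n).length = (seq m).length + 1 ∨ (seq m).length = (seq n).length + 1 := by
    rcases h with h | ⟨-, -, h | h⟩
    · exact Or.inl h.2
    · obtain ⟨-, -, a, h⟩ := isParent_iff.1 h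
      simp [h]
    · obtain ⟨-, -, a, h⟩ := isParent_iff.1 h
      simp [h]
  have hne {i j : ℕ} (hij : i ≠ j) : φ i ≠ φ j := hφ.ne hij
  have n01 := hne (show 0 ≠ 1 by decide)
  have n02 := hne (show 0 ≠ 2 by decide)
  have n12 := hne (show 1 ≠ 2 by decide)
  have n03 := hne (show 0 ≠ 3 by decide)
  have n13 := hne (show 1 ≠ 3 by decide)
  have n23 := hne (show 2 ≠ 3 by decide)
  have h01 := hstep 0
  have h12 := hstep 1
  have h23 := hstep 2
  have tri : φ 0 < 3 ∧ φ 1 < 3 ∧ φ 2 < 3 := by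
    have p01 := parity h01
    have p12 := parity h12
    have p02 := parity h02
    have s01 := small h01
    have s12 := small h12
    have s02 := small h02
    have s10 := small h01.symm
    have s21 := small h12.symm
    have s20 := small h02.symm
    simp only [zero_add, Nat.reduceAdd] at *
    omega
  have h2 : φ 2 = 2 := by
    have := small h23
    simp only [Nat.reduceAdd] at *
    omega
  have big {m n : ℕ} (h : TreeAdj T m n) (hn : 3 ≤ n) :
      (seq m).reverse ∈ T ∧ (IsParent m n ∨ IsParent n m) := by
    rcases h with h | h
    · omega
    · exact ⟨h.1, h.2.2⟩
  have hpar (n : ℕ) : IsParent (φ (n + 2)) (φ (n + 3)) := by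
    induction n with
    | zero =>
      have h3 : 3 ≤ φ 3 := by omega
      rcases (big h23 h3).2 with h | h
      · exact h
      · have := h.1
        simp only [zero_add] at *
        omega
    | succ n ih =>
      have h3 : 3 ≤ φ (n + 3) := ih.1
      rcases (big (hstep (n + 3)).symm h3).2 with h | h
      · have := ih.2.symm.trans h.2
        have := hφ this
        omega
      · exact h
  have hmem (n : ℕ) : (seq (φ (n + 2))).reverse ∈ T :=
    (big (hstep (n + 2)) (hpar n).1).1
  choose f hf using fun n => (isParent_iff.1 (hpar n)).2.2
  refine ⟨f, fun n => ?_⟩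
  suffices h : (List.range n).map f = (seq (φ (n + 2))).reverse from h ▸ hmem n
  induction n with
  | zero => simp [h2, seq]
  | succ n ih => rw [List.range_succ, List.map_append, ih, hf n]; simp

end TreeToGraph

open TreeToGraph in
theorem stmt10 :
    OneOneReducible
      (fun c : ℕ => codesTree (Denumerable.ofNat Nat.Partrec.Code c) ∧
        ∃ f : ℕ → ℕ, ∀ n : ℕ,
          (List.range n).map f ∈ codedTree (Denumerable.ofNat Nat.Partrec.Code c))
      (fun c : ℕ => codesGraph (Denumerable.ofNat Nat.Partrec.Code c) ∧
        ∃ φ : H9 →g codedGraph (Denumerable.ofNat Nat.Partrec.Code c),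
          Function.Injective φ) := by
  obtain ⟨r, hr, hinj, hval⟩ := exists_reduction
  refine ⟨r, hr, hinj, fun c => ⟨?_, ?_⟩⟩
  · rintro ⟨hc, f, hf⟩
    refine ⟨codesGraph_of_codesTree (hval c) hc, ⟨ray f, ?_⟩, ray_injective f⟩
    intro m n hmn
    rw [codedGraph_adj (hval c) hc]
    have key (m n : ℕ) (h : n = m + 1 ∨ (m = 0 ∧ n = 2)) :
        TreeAdj (codedTree (Denumerable.ofNat Code c)) (ray f m) (ray f n) := by
      rcases h with rfl | ⟨rfl, rfl⟩
      · exact treeAdj_ray hf m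
      · exact Or.inl (by simp [ray])
    rcases ((SimpleGraph.fromRel_adj _ _ _).1 hmn).2 with h | h
    · exact key m n h
    · exact (key n m h).symm
  · rintro ⟨hd, φ, hφ⟩
    have hc := codesTree_of_codesGraph (hval c) hd
    refine ⟨hc, exists_path_of_injective hφ (fun n => ?_) ?_⟩
    · rw [← codedGraph_adj (hval c) hc]
      exact φ.map_adj ((SimpleGraph.fromRel_adj _ _ _).2 ⟨by omega, by simp⟩)
    · rw [← codedGraph_adj (hval c) hc]
      exact φ.map_adj ((SimpleGraph.fromRel_adj _ _ _).2 ⟨by omega, by simp⟩)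
end

section
/- Fix n : ℕ. Let T be a tree. Then there exists an injective graph homomorphism from H_n into G_T(n) if and only if T has an infinite path. -/
/-- Base relation of `H_n`: a triangle on `Fin 3` with designated vertex `t₀ = inl 0`;
for each `k : ℕ` a `(2n+4)`-cycle block `D_k` on `ZMod (2n+4)` (with `v⁰ = 0` and its
antipode `v¹ = n+2`); an edge from `t₀` to the `v⁰` of `D_0`; and an edge from the `v¹` of
`D_k` to the `v⁰` of `D_{k+1}`. -/
def relH (n : ℕ) : Fin 3 ⊕ ℕ × ZMod (2 * n + 4) → Fin 3 ⊕ ℕ × ZMod (2 * n + 4) → Prop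
  | Sum.inl _, Sum.inl _ => True
  | Sum.inl i, Sum.inr (k, x) => i = 0 ∧ k = 0 ∧ x = 0
  | Sum.inr (k, x), Sum.inr (k', x') =>
      (k' = k ∧ x' = x + 1) ∨
      (k' = k + 1 ∧ x = (n + 2 : ZMod (2 * n + 4)) ∧ x' = 0)
  | _, _ => False

/-- The graph `H_n`: an infinite chain of `(2n+4)`-cycle blocks with a triangle at one end. -/
def Hn (n : ℕ) : SimpleGraph (Fin 3 ⊕ ℕ × ZMod (2 * n + 4)) :=
  SimpleGraph.fromRel (relH n)

/-- Vertices of `G_T(n)`: a triangle on `Fin 3` (with `t₀ = inl 0`) together with a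
`(2n+4)`-cycle block `C_σ` for each nonempty `σ ∈ T`. -/
def VG (T : Set (List ℕ)) (n : ℕ) : Type :=
  Fin 3 ⊕ ({σ : List ℕ // σ ∈ T ∧ σ ≠ []} × ZMod (2 * n + 4))

/-- Base relation of `G_T(n)`: the triangle; the cycle edges of each block `C_σ` (with
`v⁰ = 0` and its antipode `v¹ = n+2`); an edge from `t₀` to the `v⁰` of `C_σ` for each
`σ ∈ T` of length `1`; and an edge from the `v¹` of `C_σ` to the `v⁰` of `C_τ` whenever
`τ = σ ++ [m]` for some `m`. -/
def relG (T : Set (List ℕ)) (n : ℕ) : VG T n → VG T n → Prop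
  | Sum.inl _, Sum.inl _ => True
  | Sum.inl i, Sum.inr (σ, x) => i = 0 ∧ σ.1.length = 1 ∧ x = 0
  | Sum.inr (σ, x), Sum.inr (τ, y) =>
      (σ = τ ∧ y = x + 1) ∨
      (x = (n + 2 : ZMod (2 * n + 4)) ∧ y = 0 ∧ ∃ m : ℕ, τ.1 = σ.1 ++ [m])
  | _, _ => False

/-- The graph `G_T(n)`. -/
def Gn (T : Set (List ℕ)) (n : ℕ) : SimpleGraph (VG T n) :=
  SimpleGraph.fromRel (relG T n)

section Arithmetic

variable (n : ℕ)

lemma natCast_antipode_ring : ((n : ZMod (2 * n + 4)) + 2) + (n + 2) = 0 := by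
  have h : ((2 * n + 4 : ℕ) : ZMod (2 * n + 4)) = 0 := ZMod.natCast_self _
  push_cast at h
  linear_combination h

lemma natCast_ne_zero_of_lt {j : ℕ} (h₀ : 0 < j) (h : j < 2 * n + 4) :
    (j : ZMod (2 * n + 4)) ≠ 0 := by
  rw [Ne, ZMod.natCast_eq_zero_iff]
  exact Nat.not_dvd_of_pos_of_lt h₀ h

lemma antipode_ne_zero : (n + 2 : ZMod (2 * n + 4)) ≠ 0 := by
  exact_mod_cast natCast_ne_zero_of_lt n (j := n + 2) (by omega) (by omega)

lemma two_ne_zero_cycle : (2 : ZMod (2 * n + 4)) ≠ 0 := by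
  exact_mod_cast natCast_ne_zero_of_lt n (j := 2) (by omega) (by omega)

lemma natCast_ne_antipode {j : ℕ} (h : j < n + 2) :
    (j : ZMod (2 * n + 4)) ≠ n + 2 := by
  intro h'
  refine natCast_ne_zero_of_lt n (j := n + 2 - j) (by omega) (by omega) ?_
  rw [Nat.cast_sub h.le]
  push_cast
  rw [h', sub_self]

end Arithmetic

section Adjacency

variable {T : Set (List ℕ)} {n : ℕ}

lemma Gn_adj_iff {u v : VG T n} :
    (Gn T n).Adj u v ↔ u ≠ v ∧ (relG T n u v ∨ relG T n v u) :=
  SimpleGraph.fromRel_adj _ u v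

lemma Gn_adj_inl_inl {i j : Fin 3} :
    (Gn T n).Adj (Sum.inl i) (Sum.inl j) ↔ i ≠ j := by
  refine Gn_adj_iff.trans ?_
  constructor
  · rintro ⟨h, -⟩ rfl
    exact h rfl
  · exact fun h => ⟨fun h' => h (Sum.inl.inj h'), Or.inl trivial⟩

lemma Gn_adj_inl_inr {i : Fin 3} {σ : {σ : List ℕ // σ ∈ T ∧ σ ≠ []}} {x : ZMod (2 * n + 4)} :
    (Gn T n).Adj (Sum.inl i) (Sum.inr (σ, x)) ↔ i = 0 ∧ σ.1.length = 1 ∧ x = 0 := by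
  refine Gn_adj_iff.trans ?_
  constructor
  · rintro ⟨-, h | h⟩
    · exact h
    · exact h.elim
  · exact fun h => ⟨Sum.inl_ne_inr, Or.inl h⟩

lemma Gn_adj_inr_inr {σ τ : {σ : List ℕ // σ ∈ T ∧ σ ≠ []}} {x y : ZMod (2 * n + 4)}
    (h : (Gn T n).Adj (Sum.inr (σ, x)) (Sum.inr (τ, y))) :
    (σ = τ ∧ (y = x + 1 ∨ x = y + 1)) ∨
      (x = n + 2 ∧ y = 0 ∧ ∃ m : ℕ, τ.1 = σ.1 ++ [m]) ∨
      (y = n + 2 ∧ x = 0 ∧ ∃ m : ℕ, σ.1 = τ.1 ++ [m]) := by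
  rcases Gn_adj_iff.1 h with ⟨-, (h | h) | h | h⟩
  · exact Or.inl ⟨h.1, Or.inl h.2⟩
  · exact Or.inr (Or.inl h)
  · exact Or.inl ⟨h.1.symm, Or.inr h.2⟩
  · exact Or.inr (Or.inr h)

lemma Hn_adj_block (k : ℕ) (x : ZMod (2 * n + 4)) :
    (Hn n).Adj (Sum.inr (k, x)) (Sum.inr (k, x + 1)) := by
  rw [Hn, SimpleGraph.fromRel_adj]
  refine ⟨fun h => ?_, Or.inl (Or.inl ⟨rfl, rfl⟩)⟩
  have h1 : x = x + 1 := congrArg Prod.snd (Sum.inr.inj h)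
  exact two_ne_zero_cycle n (by linear_combination (-2) * h1)

lemma Hn_adj_link (k : ℕ) :
    (Hn n).Adj (Sum.inr (k, n + 2)) (Sum.inr (k + 1, 0)) := by
  rw [Hn, SimpleGraph.fromRel_adj]
  exact ⟨by simp, Or.inl (Or.inr ⟨rfl, rfl, rfl⟩)⟩

lemma Hn_adj_root : (Hn n).Adj (Sum.inl 0) (Sum.inr (0, 0)) := by
  rw [Hn, SimpleGraph.fromRel_adj]
  exact ⟨by simp, Or.inl ⟨rfl, rfl, rfl⟩⟩

lemma Hn_adj_triangle {i j : Fin 3} (h : i ≠ j) : (Hn n).Adj (Sum.inl i) (Sum.inl j) := by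
  rw [Hn, SimpleGraph.fromRel_adj]
  exact ⟨fun h' => h (Sum.inl.inj h'), Or.inl trivial⟩

/-- A colouring of `G_T(n)` by `ZMod 2` which is proper except on the triangle. -/
def parityColor (T : Set (List ℕ)) (n : ℕ) : VG T n → ZMod 2
  | Sum.inl _ => n
  | Sum.inr (σ, x) => ZMod.castHom (show 2 ∣ 2 * n + 4 by omega) (ZMod 2) x + (n + 3) * σ.1.length

lemma parityColor_inr_of_adj {σ : {σ : List ℕ // σ ∈ T ∧ σ ≠ []}} {x : ZMod (2 * n + 4)}
    {u : VG T n} (h : (Gn T n).Adj (Sum.inr (σ, x)) u) :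
    parityColor T n u = parityColor T n (Sum.inr (σ, x)) + 1 := by
  have h2 : (2 : ZMod 2) = 0 := rfl
  rcases u with i | ⟨τ, y⟩
  · obtain ⟨-, hl, rfl⟩ := Gn_adj_inl_inr.1 h.symm
    simp only [parityColor, map_zero, hl, Nat.cast_one]
    linear_combination (-2) * h2
  · rcases Gn_adj_inr_inr h with ⟨rfl, rfl | rfl⟩ | ⟨rfl, rfl, m, hm⟩ | ⟨rfl, rfl, m, hm⟩
    · simp only [parityColor, map_add, map_one]
      ring
    · simp only [parityColor, map_add, map_one]
      linear_combination -h2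
    · simp only [parityColor, map_add, map_zero, map_natCast, map_ofNat, hm, List.length_append,
        List.length_singleton, Nat.cast_add, Nat.cast_one]
      ring
    · simp only [parityColor, map_add, map_zero, map_natCast, map_ofNat, hm, List.length_append,
        List.length_singleton, Nat.cast_add, Nat.cast_one]
      linear_combination -h2

/-- Every triangle of `G_T(n)` consists of vertices of the designated triangle. -/
lemma exists_eq_inl_of_triangle_s11 {a b c : VG T n} (hab : (Gn T n).Adj a b)
    (hac : (Gn T n).Adj a c) (hbc : (Gn T n).Adj b c) : ∃ i : Fin 3, a = Sum.inl i := by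
  rcases a with i | ⟨σ, x⟩
  · exact ⟨i, rfl⟩
  exfalso
  have hb := parityColor_inr_of_adj hab
  have hc := parityColor_inr_of_adj hac
  rcases b with i | ⟨τ, y⟩
  · rcases c with j | ⟨ρ, z⟩
    · have hi := (Gn_adj_inl_inr.1 hab.symm).1
      have hj := (Gn_adj_inl_inr.1 hac.symm).1
      exact Gn_adj_inl_inl.1 hbc (hi.trans hj.symm)
    · have := parityColor_inr_of_adj hbc.symm
      rw [hb, hc] at this
      simp at this
  · have := parityColor_inr_of_adj hbc
    rw [hb, hc] at this
    simp at this

end Adjacency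

section Embedding

variable {T : Set (List ℕ)} {n : ℕ} (φ : Hn n →g Gn T n)

/-- The homomorphism `φ` sends the base point of `D_k` to that of `C_σ`, and the neighbour of the
latter outside `C_σ` is the image of a vertex outside `D_k`. -/
def EntersBlock (k : ℕ) (σ : {σ : List ℕ // σ ∈ T ∧ σ ≠ []}) : Prop :=
  φ (Sum.inr (k, 0)) = Sum.inr (σ, 0) ∧
    ∀ u, (Gn T n).Adj (Sum.inr (σ, 0)) u →
      (∃ x, u = Sum.inr (σ, x)) ∨ ∃ w, (∀ x, w ≠ Sum.inr (k, x)) ∧ φ w = u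

variable {φ} {k : ℕ} {σ : {σ : List ℕ // σ ∈ T ∧ σ ≠ []}}

lemma exists_map_neighbor_base (hφ : Function.Injective φ) (h : EntersBlock φ k σ)
    {t : ZMod (2 * n + 4)} (ht : (Hn n).Adj (Sum.inr (k, 0)) (Sum.inr (k, t))) :
    ∃ s : ZMod (2 * n + 4), (s = 1 ∨ s = -1) ∧ φ (Sum.inr (k, t)) = Sum.inr (σ, s) := by
  have ha := φ.map_adj ht
  rw [h.1] at ha
  rcases h.2 _ ha with ⟨s, hs⟩ | ⟨w, hw, hw'⟩
  · refine ⟨s, ?_, hs⟩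
    rw [hs] at ha
    rcases Gn_adj_inr_inr ha with ⟨-, h1 | h1⟩ | ⟨h1, -, -⟩ | ⟨-, -, m, hm⟩
    · exact Or.inl (by simpa using h1)
    · exact Or.inr (by linear_combination -h1)
    · exact absurd h1.symm (antipode_ne_zero n)
    · simp at hm
  · exact absurd (hφ hw') (hw t)

/-- Images along an arc of `D_k` from its base point to the antipode are forced by the image of
the first vertex. -/
lemma map_arc (hφ : Function.Injective φ) (h0 : φ (Sum.inr (k, 0)) = Sum.inr (σ, 0))
    {t s : ZMod (2 * n + 4)} (ht : t = 1 ∨ t = -1) (hs : s = 1 ∨ s = -1)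
    (h1 : φ (Sum.inr (k, t)) = Sum.inr (σ, s)) (j : ℕ) (hj : j ≤ n + 1) :
    φ (Sum.inr (k, t * j)) = Sum.inr (σ, s * j) ∧
      φ (Sum.inr (k, t * (j + 1))) = Sum.inr (σ, s * (j + 1)) := by
  induction j with
  | zero => simpa using ⟨h0, h1⟩
  | succ j ih =>
    obtain ⟨hj0, hj1⟩ := ih (by omega)
    push_cast
    refine ⟨hj1, ?_⟩
    have hadj : (Hn n).Adj (Sum.inr (k, t * (j + 1))) (Sum.inr (k, t * (j + 1 + 1))) := by
      rcases ht with rfl | rfl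
      · convert Hn_adj_block k _ using 3
        ring
      · refine SimpleGraph.Adj.symm ?_
        convert Hn_adj_block k _ using 3
        ring
    have ha := φ.map_adj hadj
    have hne0 : ((j + 1 : ℕ) : ZMod (2 * n + 4)) ≠ 0 :=
      natCast_ne_zero_of_lt n (by omega) (by omega)
    have hneA : ((j + 1 : ℕ) : ZMod (2 * n + 4)) ≠ n + 2 := natCast_ne_antipode n (by omega)
    push_cast at hne0 hneA
    have hs0 : s * (j + 1) ≠ 0 := by
      rcases hs with rfl | rfl
      · simpa using hne0
      · intro h
        exact hne0 (by linear_combination -h)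
    have hsA : s * (j + 1) ≠ n + 2 := by
      rcases hs with rfl | rfl
      · simpa using hneA
      · intro h
        exact hneA (by linear_combination -h - natCast_antipode_ring n)
    have hback : φ (Sum.inr (k, t * (j + 1 + 1))) ≠ Sum.inr (σ, s * j) := by
      rw [← hj0]
      intro h
      have h' : t * (j + 1 + 1) = t * j := congrArg Prod.snd (Sum.inr.inj (hφ h))
      refine two_ne_zero_cycle n ?_
      rcases ht with rfl | rfl
      · linear_combination h'
      · linear_combination -h'
    rw [hj1] at ha
    revert ha hback
    generalize φ (Sum.inr (k, t * (j + 1 + 1))) = u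
    intro ha hback
    rcases u with i | ⟨τ, y⟩
    · exact absurd (Gn_adj_inl_inr.1 ha.symm).2.2 hs0
    · rcases Gn_adj_inr_inr ha with ⟨rfl, h | h⟩ | ⟨h, -⟩ | ⟨-, h, -⟩
      · rcases hs with rfl | rfl
        · rw [h]
          congr 2
          ring
        · refine absurd ?_ hback
          rw [h]
          congr 2
          ring
      · rcases hs with rfl | rfl
        · refine absurd ?_ hback
          congr 2
          linear_combination -h
        · congr 2
          linear_combination -h
      · exact absurd h hsA
      · exact absurd h hs0

lemma EntersBlock.exists_succ (hφ : Function.Injective φ) (h : EntersBlock φ k σ) :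
    ∃ τ : {σ : List ℕ // σ ∈ T ∧ σ ≠ []},
      EntersBlock φ (k + 1) τ ∧ ∃ m : ℕ, τ.1 = σ.1 ++ [m] := by
  have hN := natCast_antipode_ring n
  obtain ⟨s, hs, h1⟩ := exists_map_neighbor_base hφ h (t := 1)
    (by simpa using Hn_adj_block k 0)
  obtain ⟨s', hs', h1'⟩ := exists_map_neighbor_base hφ h (t := -1)
    (by simpa using (Hn_adj_block k (-1 : ZMod (2 * n + 4))).symm)
  have hss : s ≠ s' := by
    rintro rfl
    have h' : (1 : ZMod (2 * n + 4)) = -1 :=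
      congrArg Prod.snd (Sum.inr.inj (hφ (h1.trans h1'.symm)))
    exact two_ne_zero_cycle n (by linear_combination h')
  obtain ⟨ha, hb⟩ := map_arc hφ h.1 (Or.inl rfl) hs h1 (n + 1) le_rfl
  obtain ⟨ha', -⟩ := map_arc hφ h.1 (Or.inr rfl) hs' h1' (n + 1) le_rfl
  push_cast at ha hb ha'
  have hend : φ (Sum.inr (k, n + 2)) = Sum.inr (σ, (n + 2 : ZMod (2 * n + 4))) := by
    have hs2 : s * (n + 1 + 1) = n + 2 := by
      rcases hs with rfl | rfl
      · ring
      · linear_combination -hN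
    have ht2 : (1 : ZMod (2 * n + 4)) * (n + 1 + 1) = n + 2 := by ring
    rwa [hs2, ht2] at hb
  have hcover : ∀ r : ZMod (2 * n + 4), r = 1 ∨ r = -1 →
      ∃ x, φ (Sum.inr (k, x)) = Sum.inr (σ, r * (n + 1)) := by
    intro r hr
    by_cases hrs : r = s
    · exact ⟨_, hrs ▸ ha⟩
    · have hrs' : r = s' := by
        rcases hr with rfl | rfl <;> rcases hs with rfl | rfl <;> rcases hs' with rfl | rfl <;>
          first | rfl | exact absurd rfl hrs | exact absurd rfl hss
      exact ⟨_, hrs' ▸ ha'⟩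
  have hout : ∀ r : ZMod (2 * n + 4), r = 1 ∨ r = -1 →
      φ (Sum.inr (k + 1, 0)) ≠ Sum.inr (σ, r * (n + 1)) := by
    intro r hr h'
    obtain ⟨x, hx⟩ := hcover r hr
    have := congrArg Prod.fst (Sum.inr.inj (hφ (h'.trans hx.symm)))
    simp at this
  have hadj := φ.map_adj (Hn_adj_link k)
  rw [hend] at hadj
  rcases hu : φ (Sum.inr (k + 1, 0)) with i | ⟨τ, y⟩
  · rw [hu] at hadj
    exact absurd (Gn_adj_inl_inr.1 hadj.symm).2.2 (antipode_ne_zero n)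
  rw [hu] at hadj
  rcases Gn_adj_inr_inr hadj with ⟨rfl, hy | hy⟩ | ⟨-, rfl, m, hm⟩ | ⟨-, hy, -⟩
  · refine absurd ?_ (hout (-1) (Or.inr rfl))
    rw [hu]
    congr 2
    linear_combination hy + hN
  · refine absurd ?_ (hout 1 (Or.inl rfl))
    rw [hu]
    congr 2
    linear_combination -hy
  · refine ⟨τ, ⟨hu, ?_⟩, m, hm⟩
    intro u hadj'
    rcases u with i | ⟨ρ, z⟩
    · have hl := (Gn_adj_inl_inr.1 hadj'.symm).2.1
      rw [hm] at hl
      simp [σ.2.2] at hl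
    · rcases Gn_adj_inr_inr hadj' with ⟨rfl, -⟩ | ⟨h', -⟩ | ⟨rfl, -, m', hm'⟩
      · exact Or.inl ⟨z, rfl⟩
      · exact absurd h'.symm (antipode_ne_zero n)
      · have hρ : ρ = σ := Subtype.ext (List.append_inj_left' (hm'.symm.trans hm) rfl)
        subst hρ
        exact Or.inr ⟨Sum.inr (k, n + 2), by simp, hend⟩
  · exact absurd hy (antipode_ne_zero n)

lemma exists_entersBlock_zero (hφ : Function.Injective φ) :
    ∃ σ : {σ : List ℕ // σ ∈ T ∧ σ ≠ []}, EntersBlock φ 0 σ ∧ σ.1.length = 1 := by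
  have htri : ∀ i : Fin 3, ∃ j : Fin 3, φ (Sum.inl i) = Sum.inl j := by
    intro i
    have h1 : i ≠ i + 1 := by revert i; decide
    have h2 : i ≠ i + 2 := by revert i; decide
    have h3 : i + 1 ≠ i + 2 := by revert i; decide
    exact exists_eq_inl_of_triangle_s11 (φ.map_adj (Hn_adj_triangle h1))
      (φ.map_adj (Hn_adj_triangle h2)) (φ.map_adj (Hn_adj_triangle h3))
  choose g hg using htri
  have hginj : Function.Injective g := by
    intro i j hij
    refine Sum.inl.inj (hφ ?_)
    rw [hg, hg, hij]
  have hadj := φ.map_adj (Hn_adj_root (n := n))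
  rw [hg] at hadj
  rcases hu : φ (Sum.inr (0, 0)) with i | ⟨σ, y⟩
  · obtain ⟨j, rfl⟩ := (Finite.injective_iff_surjective.1 hginj) i
    exact absurd (hφ ((hg j).trans hu.symm)) Sum.inl_ne_inr
  rw [hu] at hadj
  obtain ⟨hg0, hl, rfl⟩ := Gn_adj_inl_inr.1 hadj
  refine ⟨σ, ⟨hu, ?_⟩, hl⟩
  intro u hadj'
  rcases u with i | ⟨ρ, z⟩
  · obtain ⟨rfl, -⟩ := Gn_adj_inl_inr.1 hadj'.symm
    exact Or.inr ⟨Sum.inl 0, fun _ => Sum.inl_ne_inr, (hg 0).trans (congrArg Sum.inl hg0)⟩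
  · rcases Gn_adj_inr_inr hadj' with ⟨rfl, -⟩ | ⟨h', -⟩ | ⟨-, -, m, hm⟩
    · exact Or.inl ⟨z, rfl⟩
    · exact absurd h'.symm (antipode_ne_zero n)
    · rw [hm] at hl
      simp [ρ.2.2] at hl

lemma exists_path_of_injective (hT : IsTree T) (hφ : Function.Injective φ) :
    ∃ f : ℕ → ℕ, ∀ k : ℕ, (List.range k).map f ∈ T := by
  obtain ⟨σ₀, h₀, hl⟩ := exists_entersBlock_zero hφ
  choose! next hnext hmem using fun k σ (h : EntersBlock φ k σ) => h.exists_succ hφ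
  let s : ℕ → {σ : List ℕ // σ ∈ T ∧ σ ≠ []} := fun k => Nat.rec σ₀ (fun k σ => next k σ) k
  have hs : ∀ k, EntersBlock φ k (s k) := by
    intro k
    induction k with
    | zero => exact h₀
    | succ k ih => exact hnext k _ ih
  have hs' : ∀ k, ∃ m : ℕ, (s (k + 1)).1 = (s k).1 ++ [m] := fun k => hmem k _ (hs k)
  let f : ℕ → ℕ := fun k => (s k).1.getLast (s k).2.2
  have hf : ∀ k, (List.range (k + 1)).map f = (s k).1 := by
    intro k
    induction k with
    | zero =>
      obtain ⟨m, hm⟩ := List.length_eq_one_iff.1 hl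
      have hs0 : (s 0).1 = [m] := hm
      simp [f, hs0]
    | succ k ih =>
      obtain ⟨m, hm⟩ := hs' k
      rw [List.range_succ, List.map_append, ih]
      simp [f, hm]
  refine ⟨f, fun k => ?_⟩
  cases k with
  | zero => exact hT σ₀.2.1 List.nil_prefix
  | succ k => exact hf k ▸ (s k).2.1

lemma exists_injective_of_path {f : ℕ → ℕ} (hf : ∀ k : ℕ, (List.range k).map f ∈ T) :
    ∃ φ : Hn n →g Gn T n, Function.Injective φ := by
  let b : ℕ → {σ : List ℕ // σ ∈ T ∧ σ ≠ []} := fun k =>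
    ⟨(List.range (k + 1)).map f, hf (k + 1), by simp⟩
  let F : Fin 3 ⊕ ℕ × ZMod (2 * n + 4) → VG T n := Sum.map id (Prod.map b id)
  have hb : Function.Injective b := by
    intro k l h
    simpa [b] using congrArg (fun σ => σ.1.length) h
  have hF : Function.Injective F :=
    Function.Injective.sumMap Function.injective_id (hb.prodMap Function.injective_id)
  have hrel : ∀ u v, relH n u v → relG T n (F u) (F v) := by
    rintro (i | ⟨k, x⟩) (j | ⟨l, y⟩) h
    · trivial
    · obtain ⟨rfl, rfl, rfl⟩ := h
      exact ⟨rfl, by simp [b], rfl⟩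
    · exact h.elim
    · rcases h with ⟨rfl, rfl⟩ | ⟨rfl, rfl, rfl⟩
      · exact Or.inl ⟨rfl, rfl⟩
      · exact Or.inr ⟨rfl, rfl, f (k + 1), by simp [b, List.range_succ]⟩
  refine ⟨⟨F, ?_⟩, hF⟩
  rintro u v h
  rw [Hn, SimpleGraph.fromRel_adj] at h
  rw [Gn_adj_iff]
  exact ⟨hF.ne h.1, h.2.imp (hrel u v) (hrel v u)⟩

end Embedding

theorem stmt11 (n : ℕ) (T : Set (List ℕ)) (hT : IsTree T) :
    (∃ φ : Hn n →g Gn T n, Function.Injective φ) ↔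
    ∃ f : ℕ → ℕ, ∀ k : ℕ, (List.range k).map f ∈ T :=
  ⟨fun ⟨_, hφ⟩ => exists_path_of_injective hT hφ, fun ⟨_, hf⟩ => exists_injective_of_path hf⟩
end

section
/- If n ≠ m, then for every tree T there is no injective graph homomorphism from H_n into G_T(m) (because the cycle lengths 2n+4 and 2m+4 differ). -/
/-- A nonempty subset of `ZMod N` closed under adding `1` is everything. -/
theorem ZMod.forall_of_add_one {N : ℕ} [NeZero N] {P : ZMod N → Prop} {a : ZMod N}
    (ha : P a) (h : ∀ i, P i → P (i + 1)) (b : ZMod N) : P b := by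
  have key : ∀ k : ℕ, P (a + k) := by
    intro k
    induction k with
    | zero => simpa using ha
    | succ k ih => simpa [add_assoc] using h _ ih
  simpa using key (b - a).val

/-- A nonempty subset of `ZMod N` closed under subtracting `1` is everything. -/
theorem ZMod.forall_of_sub_one {N : ℕ} [NeZero N] {P : ZMod N → Prop} {a : ZMod N}
    (ha : P a) (h : ∀ i, P (i + 1) → P i) (b : ZMod N) : P b := by
  by_contra hb
  exact ZMod.forall_of_add_one (P := fun i => ¬ P i) hb (fun i hi hi' => hi (h i hi')) a ha

theorem ZMod.two_ne_zero_of_even_length (n : ℕ) : (2 : ZMod (2 * n + 4)) ≠ 0 := by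
  intro h
  have h' : ((2 : ℕ) : ZMod (2 * n + 4)) = 0 := by exact_mod_cast h
  rw [ZMod.natCast_eq_zero_iff] at h'
  have := Nat.le_of_dvd (by norm_num) h'
  omega

/-- An injective closed walk of length `N` in a cycle of length `M` forces `N = M`. -/
theorem ZMod.eq_of_injective_step {N M : ℕ} [NeZero N] [NeZero M] (h2 : (2 : ZMod N) ≠ 0)
    (f : ZMod N → ZMod M) (hf : Function.Injective f)
    (hstep : ∀ i, f (i + 1) = f i + 1 ∨ f i = f (i + 1) + 1) : N = M := by
  have hle : N ≤ M := by
    simpa [ZMod.card] using Fintype.card_le_of_injective f hf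
  have hne : ∀ i, f (i + 1 + 1) ≠ f i := by
    intro i h
    have := hf h
    rw [add_assoc, add_eq_left, one_add_one_eq_two] at this
    exact h2 this
  have hdvd : M ∣ N := by
    rw [← ZMod.natCast_eq_zero_iff]
    rcases hstep 0 with h0 | h0
    · have hall : ∀ i, f (i + 1) = f i + 1 := by
        refine ZMod.forall_of_add_one h0 fun i hi => ?_
        refine (hstep (i + 1)).resolve_right fun h => hne i ?_
        exact add_right_cancel (h.symm.trans hi)
      have hk : ∀ k : ℕ, f k = f 0 + k := by
        intro k
        induction k with
        | zero => simp
        | succ k ih => push_cast; rw [hall, ih, add_assoc]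
      simpa using (hk N).symm
    · have hall : ∀ i, f i = f (i + 1) + 1 := by
        refine ZMod.forall_of_add_one h0 fun i hi => ?_
        refine (hstep (i + 1)).resolve_left fun h => hne i ?_
        exact h.trans hi.symm
      have hk : ∀ k : ℕ, f 0 = f k + k := by
        intro k
        induction k with
        | zero => simp
        | succ k ih => push_cast; rw [ih, hall k]; ring
      simpa using (hk N).symm
  exact le_antisymm hle (Nat.le_of_dvd (NeZero.pos N) hdvd)

/-- The depth of a vertex of `G_T(m)`: the length of the index of its block, `0` on the triangle. -/
def VG.depth {T : Set (List ℕ)} {m : ℕ} : VG T m → ℕ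
  | Sum.inl _ => 0
  | Sum.inr (σ, _) => σ.1.length

/-- The vertex lies in the block `C_σ`. -/
def VG.InBlock {T : Set (List ℕ)} {m : ℕ} (σ : {σ : List ℕ // σ ∈ T ∧ σ ≠ []}) (v : VG T m) :
    Prop :=
  ∃ x, v = Sum.inr (σ, x)

section

variable {T : Set (List ℕ)} {m : ℕ} {σ : {σ : List ℕ // σ ∈ T ∧ σ ≠ []}}

theorem Gn.adj_inBlock {x y : ZMod (2 * m + 4)}
    (h : (Gn T m).Adj (Sum.inr (σ, x)) (Sum.inr (σ, y))) : y = x + 1 ∨ x = y + 1 := by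
  rcases h with ⟨-, h | h⟩ <;> rcases h with ⟨-, h⟩ | ⟨-, -, k, h⟩
  · exact Or.inl h
  · simp at h
  · exact Or.inr h
  · simp at h

/-- The only edge leaving `C_σ` without going deeper joins `v⁰` to the triangle or to the `v¹` of
the parent block. -/
theorem Gn.adj_not_inBlock {x : ZMod (2 * m + 4)} {v : VG T m}
    (h : (Gn T m).Adj (Sum.inr (σ, x)) v) (hd : v.depth ≤ σ.1.length) (hv : ¬ v.InBlock σ) :
    x = 0 ∧ ((σ.1.length = 1 ∧ v = Sum.inl 0) ∨
      ∃ τ : {σ : List ℕ // σ ∈ T ∧ σ ≠ []}, v = Sum.inr (τ, (m + 2 : ZMod (2 * m + 4))) ∧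
        ∃ k : ℕ, σ.1 = τ.1 ++ [k]) := by
  rcases v with i | ⟨τ, y⟩
  · rcases h with ⟨-, h | h⟩
    · exact h.elim
    · obtain ⟨rfl, h1, h2⟩ := h
      exact ⟨h2, Or.inl ⟨h1, rfl⟩⟩
  · rcases h with ⟨-, h | h⟩ <;> rcases h with ⟨h, -⟩ | ⟨h1, h2, k, h3⟩
    · exact (hv ⟨y, by rw [h]⟩).elim
    · simp [VG.depth, h3] at hd
    · exact (hv ⟨y, by rw [h]⟩).elim
    · exact ⟨h2, Or.inr ⟨τ, by rw [h1], k, h3⟩⟩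

theorem Gn.exit_unique {x y : ZMod (2 * m + 4)} {v w : VG T m}
    (hv : (Gn T m).Adj (Sum.inr (σ, x)) v) (hdv : v.depth ≤ σ.1.length) (hbv : ¬ v.InBlock σ)
    (hw : (Gn T m).Adj (Sum.inr (σ, y)) w) (hdw : w.depth ≤ σ.1.length) (hbw : ¬ w.InBlock σ) :
    x = y ∧ v = w := by
  obtain ⟨rfl, hv'⟩ := Gn.adj_not_inBlock hv hdv hbv
  obtain ⟨rfl, hw'⟩ := Gn.adj_not_inBlock hw hdw hbw
  refine ⟨rfl, ?_⟩
  rcases hv' with ⟨h1, rfl⟩ | ⟨τ, rfl, k, hk⟩ <;> rcases hw' with ⟨h2, rfl⟩ | ⟨τ', rfl, k', hk'⟩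
  · rfl
  · rw [hk'] at h1
    exact (τ'.2.2 (by simpa using h1)).elim
  · rw [hk] at h2
    exact (τ.2.2 (by simpa using h2)).elim
  · have : τ = τ' := Subtype.ext (List.append_inj_left' (hk.symm.trans hk') rfl)
    rw [this]

/-- A cycle in `G_T(m)` that meets a block of maximal depth stays inside it. -/
theorem Gn.cycle_inBlock {N : ℕ} [NeZero N] (h2 : (2 : ZMod N) ≠ 0) (f : ZMod N → VG T m)
    (hf : Function.Injective f) (hadj : ∀ i, (Gn T m).Adj (f i) (f (i + 1)))
    (hd : ∀ i, (f i).depth ≤ σ.1.length) {a : ZMod N} (ha : (f a).InBlock σ) (i : ZMod N) :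
    (f i).InBlock σ := by
  by_contra hi
  obtain ⟨j, ⟨x, hx⟩, hj⟩ : ∃ j, (f j).InBlock σ ∧ ¬ (f (j + 1)).InBlock σ := by
    by_contra! h
    exact hi (ZMod.forall_of_add_one (P := fun i => (f i).InBlock σ) ha h i)
  obtain ⟨k, ⟨y, hy⟩, hk⟩ : ∃ k, (f (k + 1)).InBlock σ ∧ ¬ (f k).InBlock σ := by
    by_contra! h
    exact hi (ZMod.forall_of_sub_one (P := fun i => (f i).InBlock σ) ha h i)
  obtain ⟨hxy, hjk⟩ := Gn.exit_unique (hx ▸ hadj j) (hd _) hj (hy ▸ (hadj k).symm) (hd _) hk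
  have e1 : j = k + 1 := hf (by rw [hx, hy, hxy])
  have e2 : j + 1 = k := hf hjk
  rw [e1, add_assoc, add_eq_left, one_add_one_eq_two] at e2
  exact h2 e2

/-- The only even cycles in `G_T(m)` have length `2m+4`. -/
theorem Gn.cycle_length {n : ℕ} (f : ZMod (2 * n + 4) → VG T m) (hf : Function.Injective f)
    (hadj : ∀ i, (Gn T m).Adj (f i) (f (i + 1))) : n = m := by
  have h2 := ZMod.two_ne_zero_of_even_length n
  obtain ⟨a, ha⟩ := Finite.exists_max fun i => (f i).depth
  rcases hfa : f a with t | ⟨σ, x⟩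
  · have hinl : ∀ i, ∃ t : Fin 3, f i = Sum.inl t := by
      intro i
      rcases hfi : f i with t | ⟨σ, x⟩
      · exact ⟨t, rfl⟩
      · have := ha i
        simp only [hfi, hfa, VG.depth, Nat.le_zero, List.length_eq_zero_iff] at this
        exact (σ.2.2 this).elim
    choose g hg using hinl
    have hginj : Function.Injective g := fun i j h => hf (by rw [hg, hg, h])
    have := Fintype.card_le_of_injective g hginj
    simp [ZMod.card] at this
  · have hd : ∀ i, (f i).depth ≤ σ.1.length := fun i => by simpa [hfa, VG.depth] using ha i
    choose g hg using Gn.cycle_inBlock h2 f hf hadj hd ⟨x, hfa⟩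
    have := ZMod.eq_of_injective_step h2 g (fun i j h => hf (by rw [hg, hg, h]))
      (fun i => Gn.adj_inBlock (hg i ▸ hg (i + 1) ▸ hadj i))
    omega

end

theorem Hn.adj_block (n k : ℕ) (i : ZMod (2 * n + 4)) :
    (Hn n).Adj (Sum.inr (k, i)) (Sum.inr (k, i + 1)) := by
  refine ⟨fun h => ?_, Or.inl (Or.inl ⟨rfl, rfl⟩)⟩
  have h1 : (1 : ZMod (2 * n + 4)) = 0 := by simpa using h
  exact ZMod.two_ne_zero_of_even_length n (by linear_combination 2 * h1)

theorem stmt12 (n m : ℕ) (hnm : n ≠ m) (T : Set (List ℕ)) (hT : IsTree T) :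
    ¬ ∃ φ : Hn n →g Gn T m, Function.Injective φ := by
  rintro ⟨φ, hφ⟩
  refine hnm (Gn.cycle_length (fun i => φ (Sum.inr (0, i))) (fun i j h => ?_)
    fun i => φ.map_adj (Hn.adj_block n 0 i))
  simpa using hφ h
end

section
/- Let g : ℕ → ℕ be injective and fix n : ℕ. Let R be the simple graph on ℕ in which distinct vertices j and k are adjacent if and only if |j − k| = 1 or there exists t ≤ min j k with g t = n. Then the following are equivalent: (i) n is not in the range of g; (ii) R is 3-colorable; (iii) every connected component of R is finitely colorable. Moreover, if n is in the range of g, then R is not k-colorable for any k : ℕ. -/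
/-- The graph `R` on `ℕ`: distinct `j`, `k` adjacent iff `|j - k| = 1` or there is some
`t ≤ min j k` with `g t = n`. -/
def R14 (g : ℕ → ℕ) (n : ℕ) : SimpleGraph ℕ :=
  SimpleGraph.fromRel (fun j k => k = j + 1 ∨ ∃ t : ℕ, t ≤ min j k ∧ g t = n)

theorem R14_colorable_three {g : ℕ → ℕ} {n : ℕ} (h : n ∉ Set.range g) :
    (R14 g n).Colorable 3 := by
  refine SimpleGraph.Colorable.mono (n := 2) (by norm_num)
    ⟨SimpleGraph.Coloring.mk (fun j => Fin.ofNat 2 j) ?_⟩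
  intro j k hjk hc
  have hne : ∀ t, g t ≠ n := fun t ht => h ⟨t, ht⟩
  simp only [R14, SimpleGraph.fromRel_adj, hne, and_false, exists_false, or_false] at hjk
  have hmod : j % 2 = k % 2 := congrArg Fin.val hc
  omega

theorem R14_adj_of_le {g : ℕ → ℕ} {n t j k : ℕ} (ht : g t = n) (hj : t ≤ j) (hk : t ≤ k)
    (hjk : j ≠ k) : (R14 g n).Adj j k :=
  (SimpleGraph.fromRel_adj _ _ _).2 ⟨hjk, .inl (.inr ⟨t, le_min hj hk, ht⟩)⟩

/-- Some connected component of `R14 g n` contains an infinite clique if `n` is a value of `g`. -/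
theorem exists_component_not_colorable_of_mem_range {g : ℕ → ℕ} {n : ℕ} (h : n ∈ Set.range g) :
    ∃ C : (R14 g n).ConnectedComponent, ∀ k, ¬ ((R14 g n).induce C.supp).Colorable k := by
  obtain ⟨t, ht⟩ := h
  refine ⟨(R14 g n).connectedComponentMk t, fun k hk => ?_⟩
  have hmem (i : ℕ) : t + i ∈ ((R14 g n).connectedComponentMk t).supp := by
    rw [SimpleGraph.ConnectedComponent.mem_supp_iff, SimpleGraph.ConnectedComponent.eq]
    rcases eq_or_ne i 0 with rfl | hi
    · exact .refl _
    · exact (R14_adj_of_le ht (by omega) le_rfl (by omega)).reachable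
  have hcard := hk.card_le_of_pairwise_adj (fun i : Fin (k + 1) => ⟨t + i, hmem i⟩)
    fun i j hij => R14_adj_of_le ht (by simp) (by simp) (by simpa [Fin.ext_iff] using hij)
  simp at hcard

theorem stmt14 (g : ℕ → ℕ) (hg : Function.Injective g) (n : ℕ) :
    (n ∉ Set.range g ↔ (R14 g n).Colorable 3) ∧
    (n ∉ Set.range g ↔
      ∀ C : (R14 g n).ConnectedComponent, ∃ k : ℕ, ((R14 g n).induce C.supp).Colorable k) ∧
    (n ∈ Set.range g → ∀ k : ℕ, ¬ (R14 g n).Colorable k) := by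
  have not_all (h : n ∈ Set.range g) :
      ¬ ∀ C : (R14 g n).ConnectedComponent, ∃ k : ℕ, ((R14 g n).induce C.supp).Colorable k := by
    obtain ⟨C, hC⟩ := exists_component_not_colorable_of_mem_range h
    exact fun hall => (hall C).elim hC
  have components {k : ℕ} (h : (R14 g n).Colorable k) (C : (R14 g n).ConnectedComponent) :
      ∃ k : ℕ, ((R14 g n).induce C.supp).Colorable k :=
    ⟨k, h.of_hom (SimpleGraph.Embedding.induce C.supp).toHom⟩
  exact ⟨⟨R14_colorable_three, fun h hn => not_all hn (components h)⟩,
    ⟨fun h => components (R14_colorable_three h), fun h hn => not_all hn h⟩,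
    fun hn _ h => not_all hn (components h)⟩
end

section
/- There exists a simple graph G on ℕ whose adjacency relation is computable, such that the set {c : ℕ | Nat.Partrec.Code.ofNat c codes a recursive tree that has an infinite path} is one-one reducible to the set {c : ℕ | Nat.Partrec.Code.ofNat c codes a recursive graph from which there is an injective graph homomorphism into G}. -/
/-- The length of the sequence with code `n`. -/
def seqLength (n : ℕ) : ℕ := (Denumerable.ofNat (List ℕ) n).length

/-- The code of the sequence with code `n` with its last entry removed. -/
def seqInit (n : ℕ) : ℕ :=
  Encodable.encode (Denumerable.ofNat (List ℕ) n).reverse.tail.reverse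

/-- `j` codes a one-entry extension of the sequence coded by `i`. -/
def IsSeqChild (i j : ℕ) : Prop := seqLength j = seqLength i + 1 ∧ seqInit j = i

/-- Adjacency in the spine: the square of a ray, with its first five vertices turned into a
clique. -/
def SpineAdj (i j : ℕ) : Prop := i ≠ j ∧ ((i < 5 ∧ j < 5) ∨ (i ≤ j + 2 ∧ j ≤ i + 2))

/-- The spine vertices which may be adjacent to vertices off the spine. -/
def IsPort (i : ℕ) : Prop := i % 3 = 0 ∧ 6 ≤ i

/-- The host graph: even numbers are spine vertices, the odd number `2 * i + 1` stands for the
finite sequence with code `i`. It is joined to its one-entry extensions and to all ports but the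
`i`-th. -/
def HostAdj (m k : ℕ) : Prop :=
  (m % 2 = 0 ∧ k % 2 = 0 ∧ SpineAdj (m / 2) (k / 2)) ∨
  (m % 2 = 0 ∧ k % 2 = 1 ∧ IsPort (m / 2) ∧ m / 6 - 2 ≠ k / 2) ∨
  (m % 2 = 1 ∧ k % 2 = 0 ∧ IsPort (k / 2) ∧ k / 6 - 2 ≠ m / 2) ∨
  (m % 2 = 1 ∧ k % 2 = 1 ∧ (IsSeqChild (m / 2) (k / 2) ∨ IsSeqChild (k / 2) (m / 2)))

/-- Adjacency in the guest graph of a tree with characteristic function `S`, where `x` and `y` are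
the values of `S` at `m / 6 - 2` and `k / 6 - 2`. The odd vertices form a ray, and `2 * n + 1` is
joined to the ports of all sequences which are not members of the tree of length `n`. -/
def GuestAdj (x y m k : ℕ) : Prop :=
  (m % 2 = 0 ∧ k % 2 = 0 ∧ SpineAdj (m / 2) (k / 2)) ∨
  (m % 2 = 0 ∧ k % 2 = 1 ∧ IsPort (m / 2) ∧ (x ≠ 1 ∨ seqLength (m / 6 - 2) ≠ k / 2)) ∨
  (m % 2 = 1 ∧ k % 2 = 0 ∧ IsPort (k / 2) ∧ (y ≠ 1 ∨ seqLength (k / 6 - 2) ≠ m / 2)) ∨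
  (m % 2 = 1 ∧ k % 2 = 1 ∧ (k = m + 2 ∨ m = k + 2))

section Computability

variable {α : Type*} [Primcodable α] {f g x y : α → ℕ}

theorem primrec_seqLength : Primrec seqLength :=
  Primrec.list_length.comp (Primrec.ofNat (List ℕ))

theorem primrec_seqInit : Primrec seqInit :=
  Primrec.encode.comp (Primrec.list_reverse.comp (Primrec.list_tail.comp
    (Primrec.list_reverse.comp (Primrec.ofNat (List ℕ)))))

theorem Primrec.div_const (hf : Primrec f) (n : ℕ) : Primrec fun a => f a / n :=
  Primrec.nat_div.comp hf (Primrec.const n)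

theorem Primrec.add_const (hf : Primrec f) (n : ℕ) : Primrec fun a => f a + n :=
  Primrec.nat_add.comp hf (Primrec.const n)

theorem Primrec.sub_const (hf : Primrec f) (n : ℕ) : Primrec fun a => f a - n :=
  Primrec.nat_sub.comp hf (Primrec.const n)

theorem Primrec.modEqConst (hf : Primrec f) (n r : ℕ) : PrimrecPred fun a => f a % n = r :=
  Primrec.eq.comp (Primrec.nat_mod.comp hf (Primrec.const n)) (Primrec.const r)

theorem primrecPred_isSeqChild (hf : Primrec f) (hg : Primrec g) :
    PrimrecPred fun a => IsSeqChild (f a) (g a) :=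
  (Primrec.eq.comp (primrec_seqLength.comp hg) ((primrec_seqLength.comp hf).add_const 1)).and
    (Primrec.eq.comp (primrec_seqInit.comp hg) hf)

theorem primrecPred_spineAdj (hf : Primrec f) (hg : Primrec g) :
    PrimrecPred fun a => SpineAdj (f a) (g a) :=
  (Primrec.eq.comp hf hg).not.and
    (((Primrec.nat_lt.comp hf (.const 5)).and (Primrec.nat_lt.comp hg (.const 5))).or
      ((Primrec.nat_le.comp hf (hg.add_const 2)).and (Primrec.nat_le.comp hg (hf.add_const 2))))

theorem primrecPred_isPort (hf : Primrec f) : PrimrecPred fun a => IsPort (f a) :=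
  (hf.modEqConst 3 0).and (Primrec.nat_le.comp (.const 6) hf)

theorem primrecPred_hostAdj (hf : Primrec f) (hg : Primrec g) :
    PrimrecPred fun a => HostAdj (f a) (g a) := by
  have key : ∀ {f g : α → ℕ}, Primrec f → Primrec g →
      PrimrecPred fun a => f a / 6 - 2 ≠ g a / 2 := fun hf hg =>
    (Primrec.eq.comp ((hf.div_const 6).sub_const 2) (hg.div_const 2)).not
  have f2 := hf.div_const 2
  have g2 := hg.div_const 2
  exact ((hf.modEqConst 2 0).and ((hg.modEqConst 2 0).and (primrecPred_spineAdj f2 g2))).or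
    (((hf.modEqConst 2 0).and ((hg.modEqConst 2 1).and
        ((primrecPred_isPort f2).and (key hf hg)))).or
    (((hf.modEqConst 2 1).and ((hg.modEqConst 2 0).and
        ((primrecPred_isPort g2).and (key hg hf)))).or
    ((hf.modEqConst 2 1).and ((hg.modEqConst 2 1).and
        ((primrecPred_isSeqChild f2 g2).or (primrecPred_isSeqChild g2 f2))))))

theorem primrecPred_guestAdj (hx : Primrec x) (hy : Primrec y) (hf : Primrec f)
    (hg : Primrec g) : PrimrecPred fun a => GuestAdj (x a) (y a) (f a) (g a) := by
  have key : ∀ {x f g : α → ℕ}, Primrec x → Primrec f → Primrec g →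
      PrimrecPred fun a => x a ≠ 1 ∨ seqLength (f a / 6 - 2) ≠ g a / 2 := fun hx hf hg =>
    (Primrec.eq.comp hx (.const 1)).not.or (Primrec.eq.comp
      (primrec_seqLength.comp ((hf.div_const 6).sub_const 2)) (hg.div_const 2)).not
  have f2 := hf.div_const 2
  have g2 := hg.div_const 2
  exact ((hf.modEqConst 2 0).and ((hg.modEqConst 2 0).and (primrecPred_spineAdj f2 g2))).or
    (((hf.modEqConst 2 0).and ((hg.modEqConst 2 1).and
        ((primrecPred_isPort f2).and (key hx hf hg)))).or
    (((hf.modEqConst 2 1).and ((hg.modEqConst 2 0).and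
        ((primrecPred_isPort g2).and (key hy hg hf)))).or
    ((hf.modEqConst 2 1).and ((hg.modEqConst 2 1).and
        ((Primrec.eq.comp hg (hf.add_const 2)).or (Primrec.eq.comp hf (hg.add_const 2)))))))

end Computability

theorem SpineAdj.symm {i j : ℕ} (h : SpineAdj i j) : SpineAdj j i := by
  unfold SpineAdj at *; omega

theorem HostAdj.symm {m k : ℕ} (h : HostAdj m k) : HostAdj k m := by
  unfold HostAdj at *
  have := @SpineAdj.symm (m / 2) (k / 2)
  tauto

theorem GuestAdj.symm {x y m k : ℕ} (h : GuestAdj x y m k) : GuestAdj y x k m := by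
  unfold GuestAdj at *
  have := @SpineAdj.symm (m / 2) (k / 2)
  tauto

theorem not_isSeqChild_self (i : ℕ) : ¬ IsSeqChild i i := by
  rintro ⟨h, -⟩; omega

theorem HostAdj.irrefl (m : ℕ) : ¬ HostAdj m m := by
  have := not_isSeqChild_self (m / 2)
  unfold HostAdj SpineAdj
  grind

theorem GuestAdj.irrefl (x y m : ℕ) : ¬ GuestAdj x y m m := by
  unfold GuestAdj SpineAdj
  omega

/-- The host graph as a simple graph. -/
def hostGraph : SimpleGraph ℕ where
  Adj := HostAdj
  symm := ⟨fun _ _ => HostAdj.symm⟩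
  loopless := ⟨HostAdj.irrefl⟩

/-! ### Sequence codes -/

theorem isSeqChild_encode (l : List ℕ) (a : ℕ) :
    IsSeqChild (Encodable.encode l) (Encodable.encode (l ++ [a])) := by
  simp [IsSeqChild, seqLength, seqInit]

theorem IsSeqChild.exists_append {i j : ℕ} (h : IsSeqChild i j) :
    ∃ a, Denumerable.ofNat (List ℕ) j = Denumerable.ofNat (List ℕ) i ++ [a] := by
  obtain ⟨h₁, h₂⟩ := h
  rw [← h₂]
  simp only [seqInit, Denumerable.ofNat_encode]
  rcases List.eq_nil_or_concat (Denumerable.ofNat (List ℕ) j) with h | ⟨l, a, h⟩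
  · simp [seqLength, h] at h₁
  · exact ⟨a, by simp [h]⟩

/-! ### Rigidity of the spine -/

/-- A vertex adjacent to two distinct adjacent spine vertices lies on the spine. -/
theorem HostAdj.even_of_triangle {m i j : ℕ} (hi : i % 2 = 0) (hj : j % 2 = 0)
    (hij : HostAdj i j) (hmi : HostAdj m i) (hmj : HostAdj m j) : m % 2 = 0 := by
  unfold HostAdj SpineAdj IsPort at *
  omega

/-- There is no triangle consisting of vertices off the spine. -/
theorem HostAdj.not_odd_triangle {m i j : ℕ} (hm : m % 2 = 1) (hi : i % 2 = 1) (hj : j % 2 = 1)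
    (hij : HostAdj i j) (hmi : HostAdj m i) (hmj : HostAdj m j) : False := by
  unfold HostAdj IsSeqChild at *
  omega

/-- A clique on five vertices in the host lies in the first five spine vertices. -/
theorem HostAdj.clique_five {v : ℕ → ℕ}
    (h : ∀ i < 5, ∀ j < 5, i ≠ j → HostAdj (v i) (v j)) :
    ∀ i < 5, v i % 2 = 0 ∧ v i / 2 < 5 := by
  have three : ∀ i < 5, ∃ j < 5, ∃ k < 5, ∃ l < 5,
      i ≠ j ∧ i ≠ k ∧ i ≠ l ∧ j ≠ k ∧ j ≠ l ∧ k ≠ l := by decide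
  have even : ∀ i < 5, v i % 2 = 0 := by
    intro i hi
    by_contra hodd
    have tri : ∀ j < 5, ∀ k < 5, i ≠ j → i ≠ k → j ≠ k → v j % 2 ≠ v k % 2 := by
      intro j hj k hk hij hik hjk e
      rcases Nat.mod_two_eq_zero_or_one (v j) with h0 | h1
      · exact hodd (even_of_triangle h0 (e ▸ h0) (h j hj k hk hjk) (h i hi j hj hij)
          (h i hi k hk hik))
      · exact not_odd_triangle (by omega) h1 (e ▸ h1) (h j hj k hk hjk) (h i hi j hj hij)
          (h i hi k hk hik)
    obtain ⟨j, hj, k, hk, l, hl, h₁, h₂, h₃, h₄, h₅, h₆⟩ := three i hi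
    have := tri j hj k hk h₁ h₂ h₄
    have := tri j hj l hl h₁ h₃ h₅
    have := tri k hk l hl h₂ h₃ h₆
    omega
  have spine : ∀ i < 5, ∀ j < 5, i ≠ j → SpineAdj (v i / 2) (v j / 2) := by
    intro i hi j hj hij
    have adj := h i hi j hj hij
    have := even i hi
    have := even j hj
    unfold HostAdj at *
    rcases adj with h | h | h | h
    · exact h.2.2
    all_goals omega
  have small : ∀ i < 5, v i / 2 < 5 := by
    obtain ⟨i, hi, hmax⟩ := Finset.exists_max_image (Finset.range 5) (fun i => v i / 2) ⟨0, by simp⟩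
    simp only [Finset.mem_range] at hi hmax
    intro j hj
    refine (hmax j hj).trans_lt ?_
    by_contra! hlarge
    obtain ⟨j, hj, k, hk, l, hl, h₁, h₂, h₃, h₄, h₅, h₆⟩ := three i hi
    have near : ∀ j < 5, i ≠ j → v j / 2 + 1 = v i / 2 ∨ v j / 2 + 2 = v i / 2 := by
      intro j hj hij
      have := hmax j hj
      have := spine i hi j hj hij
      unfold SpineAdj at this
      omega
    have := near j hj h₁
    have := near k hk h₂
    have := near l hl h₃
    have := (spine j hj k hk h₄).1
    have := (spine j hj l hl h₅).1
    have := (spine k hk l hl h₆).1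
    omega
  exact fun i hi => ⟨even i hi, small i hi⟩

variable {S : ℕ → ℕ} {φ : ℕ → ℕ}

/-- An embedding of a guest graph into the host permutes each long enough initial segment of the
spine and fixes the later spine vertices. -/
theorem spine_rigid (hinj : Function.Injective φ)
    (hφ : ∀ i j, SpineAdj i j → HostAdj (φ (2 * i)) (φ (2 * j))) (n : ℕ) (hn : 5 ≤ n) :
    (∀ i < n, ∃ j < n, φ (2 * i) = 2 * j) ∧ (∀ j < n, ∃ i < n, φ (2 * i) = 2 * j) ∧
      φ (2 * n) = 2 * n := by
  have step : ∀ n, 5 ≤ n → (∀ i < n, ∃ j < n, φ (2 * i) = 2 * j) →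
      (∀ j < n, ∃ i < n, φ (2 * i) = 2 * j) → φ (2 * n) = 2 * n := by
    intro n hn h₁ h₂
    have a₁ := hφ n (n - 1) (by unfold SpineAdj; omega)
    have a₂ := hφ n (n - 2) (by unfold SpineAdj; omega)
    have a₃ := hφ (n - 1) (n - 2) (by unfold SpineAdj; omega)
    obtain ⟨j₁, hj₁, e₁⟩ := h₁ (n - 1) (by omega)
    obtain ⟨j₂, hj₂, e₂⟩ := h₁ (n - 2) (by omega)
    rw [e₁] at a₁ a₃
    rw [e₂] at a₂ a₃
    have even := HostAdj.even_of_triangle (by omega) (by omega) a₃ a₁ a₂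
    have large : n ≤ φ (2 * n) / 2 := by
      by_contra! hlt
      obtain ⟨i, hi, e⟩ := h₂ _ hlt
      have := @hinj (2 * i) (2 * n) (by omega)
      omega
    unfold HostAdj SpineAdj at *
    omega
  induction n, hn using Nat.le_induction with
  | base =>
    have h₁ : ∀ i < 5, ∃ j < 5, φ (2 * i) = 2 * j := by
      intro i hi
      have := HostAdj.clique_five (v := fun i => φ (2 * i))
        (fun i hi j hj hij => hφ i j ⟨hij, Or.inl ⟨hi, hj⟩⟩) i hi
      exact ⟨φ (2 * i) / 2, this.2, by omega⟩
    have h₂ : ∀ j < 5, ∃ i < 5, φ (2 * i) = 2 * j := by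
      choose! g hg e using h₁
      have ginj : Function.Injective fun i : Fin 5 => (⟨g i, hg i i.2⟩ : Fin 5) := by
        intro i j hij
        simp only [Fin.mk.injEq] at hij
        have := @hinj (2 * i) (2 * j) (by rw [e i i.2, e j j.2, hij])
        omega
      intro j hj
      obtain ⟨i, hi⟩ := Finite.surjective_of_injective ginj ⟨j, hj⟩
      simp only [Fin.mk.injEq] at hi
      exact ⟨i, i.2, by rw [e i i.2, hi]⟩
    exact ⟨h₁, h₂, step 5 le_rfl h₁ h₂⟩
  | succ n hn ih =>
    obtain ⟨h₁, h₂, h₃⟩ := ih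
    have low : ∀ i < n + 1, ∃ j < n + 1, φ (2 * i) = 2 * j := by
      intro i hi
      rcases Nat.lt_succ_iff_lt_or_eq.1 hi with h | rfl
      · obtain ⟨j, hj, e⟩ := h₁ i h
        exact ⟨j, by omega, e⟩
      · exact ⟨i, hi, h₃⟩
    have onto : ∀ j < n + 1, ∃ i < n + 1, φ (2 * i) = 2 * j := by
      intro j hj
      rcases Nat.lt_succ_iff_lt_or_eq.1 hj with h | rfl
      · obtain ⟨i, hi, e⟩ := h₂ j h
        exact ⟨i, by omega, e⟩
      · exact ⟨j, hj, h₃⟩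
    exact ⟨low, onto, step (n + 1) (by omega) low onto⟩

/-! ### Embeddings and infinite paths -/

theorem exists_path_of_embedding (hinj : Function.Injective φ)
    (hφ : ∀ m k, GuestAdj (S (m / 6 - 2)) (S (k / 6 - 2)) m k → HostAdj (φ m) (φ k)) :
    ∃ f : ℕ → ℕ, ∀ k, S (Encodable.encode ((List.range k).map f)) = 1 := by
  have rigid := spine_rigid hinj fun i j hij => hφ _ _ (Or.inl ⟨by omega, by omega, by
    simpa using hij⟩)
  have odd : ∀ n, φ (2 * n + 1) % 2 = 1 := by
    intro n
    by_contra hn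
    obtain ⟨i, -, e⟩ := (rigid (φ (2 * n + 1) + 5) (by omega)).2.1 (φ (2 * n + 1) / 2) (by omega)
    have := @hinj (2 * i) (2 * n + 1) (by omega)
    omega
  have member : ∀ n, S (φ (2 * n + 1) / 2) = 1 ∧ seqLength (φ (2 * n + 1) / 2) = n := by
    intro n
    by_contra hn
    set t := φ (2 * n + 1) / 2 with ht
    have e₁ : (6 * t + 12) / 6 - 2 = t := by omega
    have e₂ : (2 * n + 1) / 2 = n := by omega
    have adj := hφ (6 * t + 12) (2 * n + 1) (Or.inr (Or.inl ⟨by omega, by omega,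
      ⟨by omega, by omega⟩, by rw [e₁, e₂]; tauto⟩))
    have fix := (rigid (3 * t + 6) (by omega)).2.2
    rw [show 2 * (3 * t + 6) = 6 * t + 12 by ring] at fix
    rw [fix] at adj
    have := odd n
    unfold HostAdj at adj
    omega
  have child : ∀ n, IsSeqChild (φ (2 * n + 1) / 2) (φ (2 * (n + 1) + 1) / 2) := by
    intro n
    have adj := hφ (2 * n + 1) (2 * (n + 1) + 1) (Or.inr (Or.inr (Or.inr (by omega))))
    have := odd n
    have := odd (n + 1)
    have := (member n).2
    have := (member (n + 1)).2
    unfold HostAdj IsSeqChild at *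
    omega
  choose f hf using fun n => (child n).exists_append
  have path : ∀ n, Denumerable.ofNat (List ℕ) (φ (2 * n + 1) / 2) = (List.range n).map f := by
    intro n
    induction n with
    | zero => exact List.length_eq_zero_iff.1 (member 0).2
    | succ n ih => rw [hf, ih, List.range_succ, List.map_append]; rfl
  refine ⟨f, fun n => ?_⟩
  rw [← path, Denumerable.encode_ofNat]
  exact (member n).1

theorem exists_embedding_of_path {f : ℕ → ℕ}
    (hf : ∀ k, S (Encodable.encode ((List.range k).map f)) = 1) :
    ∃ φ : ℕ → ℕ, Function.Injective φ ∧
      ∀ m k, GuestAdj (S (m / 6 - 2)) (S (k / 6 - 2)) m k → HostAdj (φ m) (φ k) := by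
  set s : ℕ → ℕ := fun n => Encodable.encode ((List.range n).map f) with hs
  have len : ∀ n, seqLength (s n) = n := fun n => by simp [hs, seqLength]
  have child : ∀ n, IsSeqChild (s n) (s (n + 1)) := fun n => by
    simpa [hs, List.range_succ] using isSeqChild_encode ((List.range n).map f) (f n)
  have port : ∀ t n, S t ≠ 1 ∨ seqLength t ≠ n → t ≠ s n := by
    rintro t n h rfl
    rcases h with h | h
    · exact h (hf n)
    · exact h (len n)
  have e₁ : ∀ m, m % 2 = 0 → (if m % 2 = 0 then m else 2 * s (m / 2) + 1) = m := by
    intro m hm; simp [hm]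
  have e₂ : ∀ m, m % 2 = 1 →
      (if m % 2 = 0 then m else 2 * s (m / 2) + 1) = 2 * s (m / 2) + 1 := by
    intro m hm; simp [hm]
  have e₃ : ∀ n, (2 * s n + 1) / 2 = s n := fun n => by omega
  have e₄ : ∀ n, (2 * s n + 1) % 2 = 1 := fun n => by omega
  refine ⟨fun m => if m % 2 = 0 then m else 2 * s (m / 2) + 1, ?_, ?_⟩
  · intro m k h
    dsimp only at h
    rcases Nat.mod_two_eq_zero_or_one m with hm | hm <;>
      rcases Nat.mod_two_eq_zero_or_one k with hk | hk
    · rwa [e₁ m hm, e₁ k hk] at h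
    · rw [e₁ m hm, e₂ k hk] at h; omega
    · rw [e₂ m hm, e₁ k hk] at h; omega
    · rw [e₂ m hm, e₂ k hk] at h
      have := congrArg seqLength (show s (m / 2) = s (k / 2) by omega)
      rw [len, len] at this
      omega
  · rintro m k (⟨hm, hk, h⟩ | ⟨hm, hk, h, h'⟩ | ⟨hm, hk, h, h'⟩ | ⟨hm, hk, h⟩)
    · exact Or.inl (by dsimp only; rw [e₁ m hm, e₁ k hk]; exact ⟨hm, hk, h⟩)
    · refine Or.inr (Or.inl ?_)
      dsimp only
      rw [e₁ m hm, e₂ k hk, e₃]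
      exact ⟨hm, e₄ _, h, port _ _ h'⟩
    · refine Or.inr (Or.inr (Or.inl ?_))
      dsimp only
      rw [e₂ m hm, e₁ k hk, e₃]
      exact ⟨e₄ _, hk, h, port _ _ h'⟩
    · refine Or.inr (Or.inr (Or.inr ?_))
      dsimp only
      rw [e₂ m hm, e₂ k hk, e₃, e₃]
      refine ⟨e₄ _, e₄ _, h.imp (fun h => ?_) fun h => ?_⟩
      · rw [show k / 2 = m / 2 + 1 by omega]; exact child _
      · rw [show m / 2 = k / 2 + 1 by omega]; exact child _

/-! ### The reduction -/

/-- `x` and `x'` are admissible values of a characteristic function of a tree at a sequence and at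
its immediate initial segment. -/
def TreeValues (x x' : ℕ) : Prop := x ≤ 1 ∧ (x = 1 → x' = 1)

open Classical in
/-- The value of the guest graph at `(m, k)`, computed from the values of a characteristic function
at the sequences belonging to `m` and `k` and at their immediate initial segments. Inadmissible
values lead to the value `2`, which disqualifies the code. -/
noncomputable def guestValue (m k x x' y y' : ℕ) : ℕ :=
  if TreeValues x x' ∧ TreeValues y y' then (if GuestAdj x y m k then 1 else 0) else 2

/-- The partial characteristic function of the guest graph of the tree coded by `c`. -/
noncomputable def guestEval (c : Nat.Partrec.Code) (m k : ℕ) : Part ℕ :=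
  (c.eval (m / 6 - 2)).bind fun x => (c.eval (seqInit (m / 6 - 2))).bind fun x' =>
    (c.eval (k / 6 - 2)).bind fun y => (c.eval (seqInit (k / 6 - 2))).map fun y' =>
      guestValue m k x x' y y'

theorem exists_guestCode : ∃ e : Nat.Partrec.Code, ∀ c m k : ℕ,
    e.eval (Nat.pair c (Nat.pair m k)) =
      guestEval (Denumerable.ofNat Nat.Partrec.Code c) m k := by
  classical
  have index : Primrec fun n : ℕ => n / 6 - 2 := (Primrec.id.div_const 6).sub_const 2
  have fstArg : Primrec fun n : ℕ => n.unpair.2.unpair.1 :=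
    Primrec.fst.comp (Primrec.unpair.comp (Primrec.snd.comp Primrec.unpair))
  have sndArg : Primrec fun n : ℕ => n.unpair.2.unpair.2 :=
    Primrec.snd.comp (Primrec.unpair.comp (Primrec.snd.comp Primrec.unpair))
  have run : ∀ {α : Type} [Primcodable α] {f g : α → ℕ}, Primrec f → Primrec g →
      Partrec fun a => (Denumerable.ofNat Nat.Partrec.Code (f a).unpair.1).eval (g a) :=
    fun hf hg => Nat.Partrec.Code.eval_part.comp
      ((Primrec.ofNat _).comp (Primrec.fst.comp (Primrec.unpair.comp hf))).to_comp hg.to_comp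
  have values : ∀ {α : Type} [Primcodable α] {f g : α → ℕ}, Primrec f → Primrec g →
      PrimrecPred fun a => TreeValues (f a) (g a) := fun hf hg =>
    ((Primrec.nat_le.comp hf (.const 1)).and
      ((Primrec.eq.comp hf (.const 1)).not.or (Primrec.eq.comp hg (.const 1)))).of_eq
      fun _ => by unfold TreeValues; tauto
  have value : Primrec fun p : (((ℕ × ℕ) × ℕ) × ℕ) × ℕ =>
      guestValue p.1.1.1.1.unpair.2.unpair.1 p.1.1.1.1.unpair.2.unpair.2
        p.1.1.1.2 p.1.1.2 p.1.2 p.2 := by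
    have p₁ : Primrec fun p : (((ℕ × ℕ) × ℕ) × ℕ) × ℕ => p.1.1.1.1 :=
      Primrec.fst.comp (Primrec.fst.comp (Primrec.fst.comp Primrec.fst))
    have p₂ : Primrec fun p : (((ℕ × ℕ) × ℕ) × ℕ) × ℕ => p.1.1.1.2 :=
      Primrec.snd.comp (Primrec.fst.comp (Primrec.fst.comp Primrec.fst))
    have p₃ : Primrec fun p : (((ℕ × ℕ) × ℕ) × ℕ) × ℕ => p.1.1.2 :=
      Primrec.snd.comp (Primrec.fst.comp Primrec.fst)
    have p₄ : Primrec fun p : (((ℕ × ℕ) × ℕ) × ℕ) × ℕ => p.1.2 := Primrec.snd.comp Primrec.fst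
    exact Primrec.ite ((values p₂ p₃).and (values p₄ Primrec.snd))
      (Primrec.ite (primrecPred_guestAdj p₂ p₄ (fstArg.comp p₁) (sndArg.comp p₁))
        (Primrec.const 1) (Primrec.const 0)) (Primrec.const 2)
  have main : Partrec fun n : ℕ =>
      guestEval (Denumerable.ofNat Nat.Partrec.Code n.unpair.1)
        n.unpair.2.unpair.1 n.unpair.2.unpair.2 := by
    have q₂ : Primrec fun p : (ℕ × ℕ) × ℕ => p.1.1 := Primrec.fst.comp Primrec.fst
    have q₃ : Primrec fun p : ((ℕ × ℕ) × ℕ) × ℕ => p.1.1.1 :=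
      Primrec.fst.comp (Primrec.fst.comp Primrec.fst)
    refine (run Primrec.id (index.comp fstArg)).bind (Partrec.bind (run Primrec.fst
      (primrec_seqInit.comp (index.comp (fstArg.comp Primrec.fst)))) (Partrec.bind
      (run q₂ (index.comp (sndArg.comp q₂))) (Partrec.map
      (run q₃ (primrec_seqInit.comp (index.comp (sndArg.comp q₃)))) value.to_comp.to₂).to₂).to₂).to₂
  obtain ⟨e, he⟩ := Nat.Partrec.Code.exists_code.1 (Partrec.nat_iff.1 main)
  exact ⟨e, fun c m k => by rw [he]; simp⟩

theorem isPrefix_closed_iff (P : List ℕ → Prop) :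
    (∀ σ τ, P τ → σ <+: τ → P σ) ↔ ∀ τ, P τ → P τ.reverse.tail.reverse := by
  constructor
  · intro h τ hτ
    refine h _ τ hτ ?_
    rw [← List.reverse_suffix]
    simpa using List.tail_suffix τ.reverse
  · intro h σ τ hτ hp
    obtain ⟨ρ, rfl⟩ := hp
    induction ρ using List.reverseRecOn with
    | nil => simpa using hτ
    | append_singleton ρ a ih => exact ih (by simpa [← List.append_assoc] using h _ hτ)

theorem codesTree_iff (c : Nat.Partrec.Code) : codesTree c ↔
    ∃ S : ℕ → ℕ, (∀ t, c.eval t = Part.some (S t)) ∧ ∀ t, TreeValues (S t) (S (seqInit t)) := by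
  unfold codesTree
  rw [isPrefix_closed_iff (fun l => c.eval (Encodable.encode l) = Part.some 1)]
  constructor
  · rintro ⟨h₁, h₂⟩
    have h : ∀ t, ∃ x, c.eval t = Part.some x ∧ x ≤ 1 := by
      intro t
      have := h₁ (Denumerable.ofNat (List ℕ) t)
      rw [Denumerable.encode_ofNat] at this
      rcases this with h | h
      · exact ⟨0, h, by omega⟩
      · exact ⟨1, h, by omega⟩
    choose S hS hle using h
    refine ⟨S, hS, fun t => ⟨hle t, fun ht => ?_⟩⟩
    have := h₂ (Denumerable.ofNat (List ℕ) t) (by rw [Denumerable.encode_ofNat, hS, ht])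
    rw [hS] at this
    exact Part.some_injective this
  · rintro ⟨S, hS, hT⟩
    simp only [hS, Part.some_inj]
    refine ⟨fun l => ?_, fun τ h => ?_⟩
    · have := (hT (Encodable.encode l)).1
      omega
    · simpa [seqInit] using (hT (Encodable.encode τ)).2 h

theorem guestEval_of_total {c : Nat.Partrec.Code} {S : ℕ → ℕ}
    (hS : ∀ t, c.eval t = Part.some (S t)) (hT : ∀ t, TreeValues (S t) (S (seqInit t)))
    (m k : ℕ) [Decidable (GuestAdj (S (m / 6 - 2)) (S (k / 6 - 2)) m k)] :
    guestEval c m k =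
      Part.some (if GuestAdj (S (m / 6 - 2)) (S (k / 6 - 2)) m k then 1 else 0) := by
  simp [guestEval, guestValue, hS, hT]

theorem codesGraph_iff {c d : Nat.Partrec.Code}
    (hd : ∀ m k, d.eval (Nat.pair m k) = guestEval c m k) : codesGraph d ↔ codesTree c := by
  classical
  rw [codesTree_iff]
  constructor
  · intro h
    have diag : ∀ t, ∃ x, c.eval t = Part.some x ∧ ∃ x', c.eval (seqInit t) = Part.some x' ∧
        TreeValues x x' := by
      intro t
      have hval : ∃ v ≤ 1, v ∈ guestEval c (6 * t + 12) (6 * t + 12) := by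
        rw [← hd]
        rcases (h (6 * t + 12) (6 * t + 12)).1 with h | h <;> rw [h]
        · exact ⟨0, by simp⟩
        · exact ⟨1, by simp⟩
      obtain ⟨v, hv, hmem⟩ := hval
      simp only [guestEval, show (6 * t + 12) / 6 - 2 = t by omega, Part.mem_bind_iff,
        Part.mem_map_iff] at hmem
      obtain ⟨x, hx, x', hx', y, hy, y', hy', rfl⟩ := hmem
      refine ⟨x, Part.eq_some_iff.2 hx, x', Part.eq_some_iff.2 hx', ?_⟩
      by_contra hbad
      simp [guestValue, hbad] at hv
    choose S hS x' hx' hT using diag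
    refine ⟨S, hS, fun t => ?_⟩
    have := hx' t
    rw [hS] at this
    rw [Part.some_injective this]
    exact hT t
  · rintro ⟨S, hS, hT⟩ m n
    rw [hd, hd, guestEval_of_total hS hT, guestEval_of_total hS hT]
    refine ⟨?_, ?_, ?_⟩
    · split_ifs <;> simp
    · congr 2
      exact propext ⟨GuestAdj.symm, GuestAdj.symm⟩
    · rintro rfl
      simp [GuestAdj.irrefl]

theorem codedGraph_adj {c d : Nat.Partrec.Code} {S : ℕ → ℕ}
    (hd : ∀ m k, d.eval (Nat.pair m k) = guestEval c m k)
    (hS : ∀ t, c.eval t = Part.some (S t)) (hT : ∀ t, TreeValues (S t) (S (seqInit t)))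
    (m k : ℕ) :
    (codedGraph d).Adj m k ↔ GuestAdj (S (m / 6 - 2)) (S (k / 6 - 2)) m k := by
  classical
  have h : ∀ m k, d.eval (Nat.pair m k) = Part.some 1 ↔
      GuestAdj (S (m / 6 - 2)) (S (k / 6 - 2)) m k := fun m k => by
    rw [hd, guestEval_of_total hS hT, Part.some_inj]
    simp
  simp only [codedGraph, SimpleGraph.fromRel_adj, h]
  refine ⟨fun ⟨_, h⟩ => h.elim id GuestAdj.symm, fun h => ⟨?_, Or.inl h⟩⟩
  rintro rfl
  exact GuestAdj.irrefl _ _ _ h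

theorem guest_embeds_iff {c d : Nat.Partrec.Code}
    (hd : ∀ m k, d.eval (Nat.pair m k) = guestEval c m k) (hc : codesTree c) :
    (∃ φ : codedGraph d →g hostGraph, Function.Injective φ) ↔
      ∃ f : ℕ → ℕ, ∀ k, (List.range k).map f ∈ codedTree c := by
  obtain ⟨S, hS, hT⟩ := (codesTree_iff c).1 hc
  have adj := codedGraph_adj hd hS hT
  simp only [codedTree, Set.mem_ofPred_eq, hS, Part.some_inj]
  constructor
  · rintro ⟨φ, hinj⟩
    exact exists_path_of_embedding hinj fun m k h => φ.map_adj ((adj m k).2 h)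
  · rintro ⟨f, hf⟩
    obtain ⟨φ, hinj, hφ⟩ := exists_embedding_of_path hf
    exact ⟨⟨φ, fun {m k} h => hφ m k ((adj m k).1 h)⟩, hinj⟩

theorem stmt15 :
    ∃ G : SimpleGraph ℕ,
      (∃ p : ℕ → ℕ → Bool, Computable₂ p ∧ ∀ m k : ℕ, (G.Adj m k ↔ p m k = true)) ∧
      OneOneReducible
        (fun c : ℕ => codesTree (Denumerable.ofNat Nat.Partrec.Code c) ∧
          ∃ f : ℕ → ℕ, ∀ k : ℕ,
            (List.range k).map f ∈ codedTree (Denumerable.ofNat Nat.Partrec.Code c))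
        (fun c : ℕ => codesGraph (Denumerable.ofNat Nat.Partrec.Code c) ∧
          ∃ φ : codedGraph (Denumerable.ofNat Nat.Partrec.Code c) →g G,
            Function.Injective φ) := by
  classical
  obtain ⟨e, he⟩ := exists_guestCode
  refine ⟨hostGraph, ⟨fun m k => decide (HostAdj m k),
    (primrecPred_hostAdj Primrec.fst Primrec.snd).decide.to_comp, fun m k => by
      simp [hostGraph]⟩, fun c => Encodable.encode (e.curry c),
    (Primrec.encode.comp (Nat.Partrec.Code.primrec₂_curry.comp (Primrec.const e)
      Primrec.id)).to_comp, fun c c' h => (Nat.Partrec.Code.curry_inj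
        (Encodable.encode_injective h)).2, fun c => ?_⟩
  have hd : ∀ m k, (Denumerable.ofNat Nat.Partrec.Code (Encodable.encode (e.curry c))).eval
      (Nat.pair m k) = guestEval (Denumerable.ofNat Nat.Partrec.Code c) m k := fun m k => by
    rw [Denumerable.ofNat_encode, Nat.Partrec.Code.eval_curry, he]
  exact (and_congr_right fun hc => (guest_embeds_iff hd hc).symm).trans
    (and_congr_left' (codesGraph_iff hd).symm)
end
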